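/- arXiv:2601.09604 — 3 statements merged into one kernel-verified Lean document; each statement's English description precedes it below -/
import Mathlib

section
/- Let A be an n×n matrix over an algebraically closed field of characteristic 0 (or characteristic > n). There exists a nonzero diagonal matrix D such that A and A+D have the same characteristic polynomial if and only if there is some 1 ≤ k ≤ n for which the k×k principal minors of A are not all equal. -/
open Matrix

/-- The principal minor of `A` on the rows and columns indexed by `N`. -/
noncomputable def principalMinor {K : Type*} [CommRing K] {n : ℕ}
    (A : Matrix (Fin n) (Fin n) K) (N : Finset (Fin n)) : K :=
  Matrix.det (A.submatrix (fun x : {x // x ∈ N} => (x : Fin n)) fun x : {x // x ∈ N} => (x : Fin n))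

open Finset Polynomial

section MinorSum

variable {ι K R S : Type*} [Fintype ι] [DecidableEq ι] [Field K]
  [CommRing R] [Algebra K R] [CommRing S] [Algebra K S]

/-- The value at `z` of the polynomial `∑ M, q M * s ^ #M * ∏ l ∉ M, (z - x l)`. When `q M` is the
principal minor of `-A` on `M`, its value at `s = 1` is the characteristic polynomial of
`A + diagonal x` evaluated at `z`. -/
def minorSum (s : R) (q : Finset ι → K) (x : ι → R) (z : R) : R :=
  ∑ M, algebraMap K R (q M) * s ^ #M * ∏ l ∈ Mᶜ, (z - x l)

lemma map_minorSum (φ : R →ₐ[K] S) (s : R) (q : Finset ι → K) (x : ι → R) (z : R) :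
    φ (minorSum s q x z) = minorSum (φ s) q (fun i => φ (x i)) (φ z) := by
  simp [minorSum, map_sum, map_mul, map_prod]

lemma minorSum_scale (u s : R) (q : Finset ι → K) (x : ι → R) (z : R) :
    minorSum (u * s) q (fun i => u * x i) (u * z) = u ^ Fintype.card ι * minorSum s q x z := by
  simp only [minorSum, Finset.mul_sum]
  refine Finset.sum_congr rfl fun M _ => ?_
  simp only [← mul_sub, Finset.prod_mul_distrib, Finset.prod_const, mul_pow]
  rw [← Finset.card_add_card_compl M, pow_add]
  ring

lemma minorSum_zero_left {q : Finset ι → K} (hq : q ∅ = 1) (x : ι → R) (z : R) :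
    minorSum 0 q x z = ∏ l, (z - x l) := by
  rw [minorSum, Finset.sum_eq_single ∅]
  · simp [hq]
  · intro M _ hM
    simp [hM]
  · simp

lemma minorSum_zero_right {s : R} (q : Finset ι → K) (z : R) :
    minorSum s q 0 z = ∑ k ∈ range (Fintype.card ι + 1),
      algebraMap K R (∑ M ∈ powersetCard k univ, q M) * s ^ k * z ^ (Fintype.card ι - k) := by
  rw [minorSum, ← Finset.powerset_univ, Finset.sum_powerset, Finset.card_univ]
  refine Finset.sum_congr rfl fun k _ => ?_
  rw [map_sum, Finset.sum_mul, Finset.sum_mul]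
  refine Finset.sum_congr rfl fun M hM => ?_
  simp [Finset.card_compl, (Finset.mem_powersetCard.1 hM).2]

lemma minorSum_comp_perm (s : R) {a : Finset ι → K} (ha : ∀ M N, #M = #N → a M = a N)
    (σ : Equiv.Perm ι) (x : ι → R) (z : R) :
    minorSum s a (x ∘ σ) z = minorSum s a x z := by
  simp only [minorSum]
  refine Fintype.sum_equiv σ.finsetCongr _ _ fun M => ?_
  have hc : #(σ.finsetCongr M) = #M := by simp
  rw [hc, ha _ M hc]
  congr 1
  refine Finset.prod_equiv σ (fun i => ?_) fun i _ => rfl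
  simp

lemma prod_sub_prod_mem {I : Ideal R} {κ : Type*} (T : Finset κ) {f g : κ → R}
    (h : ∀ i ∈ T, f i - g i ∈ I) : ∏ i ∈ T, f i - ∏ i ∈ T, g i ∈ I := by
  rw [← Ideal.Quotient.eq, map_prod, map_prod]
  exact Finset.prod_congr rfl fun i hi => Ideal.Quotient.eq.2 (h i hi)

/-- The separation of `ν i` from the other values of `ν`. -/
def sepProd (ν : ι → K) (i : ι) : K := ∏ l ∈ univ.erase i, (ν i - ν l)

lemma sepProd_ne_zero {ν : ι → K} (hν : Function.Injective ν) (i : ι) : sepProd ν i ≠ 0 :=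
  Finset.prod_ne_zero_iff.2 fun _ hl => sub_ne_zero.2 fun h =>
    (Finset.ne_of_mem_erase hl) (hν h).symm

/-- First-order behaviour of `minorSum` near a point with coordinates `ν`. -/
lemma minorSum_sub_add_mem {q : Finset ι → K} (hq : q ∅ = 1) (ν : ι → K) {J I : Ideal R} {s : R}
    (hs : s ∈ J) {x y : ι → R} (hx : ∀ i, x i - algebraMap K R (ν i) ∈ J)
    (hy : ∀ i, y i - algebraMap K R (ν i) ∈ J) (hI : ∀ i, x i - y i ∈ I) (i : ι) :
    minorSum s q x (algebraMap K R (ν i)) - minorSum s q y (algebraMap K R (ν i)) +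
      algebraMap K R (sepProd ν i) * (x i - y i) ∈ J * I := by
  set z := algebraMap K R (ν i)
  have hdiff : ∀ T : Finset ι, ∏ l ∈ T, (z - x l) - ∏ l ∈ T, (z - y l) ∈ I := fun T =>
    prod_sub_prod_mem T fun l _ => by simpa using I.neg_mem (hI l)
  simp only [minorSum]
  rw [← Finset.sum_sub_distrib, ← Finset.add_sum_erase _ _ (Finset.mem_univ ∅), add_right_comm]
  refine Ideal.add_mem _ ?_ (Ideal.sum_mem _ fun M hM => ?_)
  · have hw : algebraMap K R (sepProd ν i) = ∏ l ∈ univ.erase i, (z - algebraMap K R (ν l)) := by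
      simp [sepProd, map_prod, z]
    have hP : ∏ l ∈ univ.erase i, (z - x l) - algebraMap K R (sepProd ν i) ∈ J := by
      rw [hw]
      exact prod_sub_prod_mem _ fun l _ => by simpa using J.neg_mem (hx l)
    simp only [hq, map_one, Finset.card_empty, pow_zero, one_mul, Finset.compl_empty]
    rw [← Finset.mul_prod_erase _ _ (Finset.mem_univ i),
      ← Finset.mul_prod_erase univ (fun l => z - y l) (Finset.mem_univ i)]
    have h1 := Ideal.mul_mem_mul hP (I.neg_mem (hI i))
    have h2 := Ideal.mul_mem_mul (J.neg_mem (hy i)) (hdiff (univ.erase i))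
    convert Ideal.add_mem _ h1 h2 using 1
    ring
  · have hM0 : #M ≠ 0 := by simpa using Finset.ne_of_mem_erase hM
    rw [← mul_sub]
    exact Ideal.mul_mem_mul (J.mul_mem_left _ (J.pow_mem_of_mem hs _ (Nat.pos_of_ne_zero hM0)))
      (hdiff _)

lemma minorSum_sub_sub_mem {q a : Finset ι → K} {k : ℕ} (hqa : ∀ M, #M < k → q M = a M)
    (ν : ι → K) {J : Ideal R} {s : R} (hs : s ∈ J) (i : ι) :
    minorSum s q (fun l => algebraMap K R (ν l)) (algebraMap K R (ν i)) -
      minorSum s a (fun l => algebraMap K R (ν l)) (algebraMap K R (ν i)) -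
      s ^ k * algebraMap K R (∑ M ∈ powersetCard k univ, (q M - a M) * ∏ l ∈ Mᶜ, (ν i - ν l)) ∈
      Ideal.span {s ^ k} * J := by
  have hsum : ∑ M ∈ powersetCard k univ, (q M - a M) * ∏ l ∈ Mᶜ, (ν i - ν l) =
      ∑ M : Finset ι, if #M = k then (q M - a M) * ∏ l ∈ Mᶜ, (ν i - ν l) else 0 := by
    rw [← Finset.sum_filter]
    refine Finset.sum_congr ?_ fun _ _ => rfl
    ext M
    simp [Finset.mem_powersetCard]
  rw [hsum, map_sum, Finset.mul_sum]
  simp only [minorSum]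
  rw [← Finset.sum_sub_distrib, ← Finset.sum_sub_distrib]
  refine Ideal.sum_mem _ fun M _ => ?_
  rcases lt_trichotomy #M k with h | h | h
  · simp [hqa M h, h.ne]
  · convert Ideal.zero_mem _ using 1
    rw [if_pos h, h]
    simp only [map_mul, map_sub, map_prod]
    ring
  · obtain ⟨e, he⟩ := Nat.exists_eq_add_of_lt h
    rw [if_neg h.ne', map_zero, mul_zero, sub_zero, ← sub_mul, ← sub_mul, he]
    have h1 := Ideal.mul_mem_mul (Ideal.mem_span_singleton_self (s ^ k)) hs
    convert Ideal.mul_mem_left _ ((algebraMap K R (q M) - algebraMap K R (a M)) *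
      s ^ e * ∏ l ∈ Mᶜ, (algebraMap K R (ν i) - algebraMap K R (ν l))) h1 using 1
    ring

end MinorSum

section LocalRing

variable {ι K R : Type*} [Fintype ι] [Field K] [CommRing R] [IsLocalRing R] [Algebra K R]

open IsLocalRing

lemma span_le_of_mul_add_mem {w : ι → K} (hw : ∀ i, w i ≠ 0) {N : Ideal R} {x c : ι → R}
    (hc : ∀ i, c i ∈ N) (h : ∀ i, c i + algebraMap K R (w i) * x i ∈
      maximalIdeal R * Ideal.span (Set.range x)) :
    Ideal.span (Set.range x) ≤ N := by
  refine Submodule.le_of_le_smul_of_le_jacobson_bot (I := maximalIdeal R)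
    (Submodule.fg_span (Set.finite_range x)) (maximalIdeal_le_jacobson _) ?_
  rw [Ideal.span_le]
  rintro _ ⟨i, rfl⟩
  have hxi : x i = algebraMap K R (w i)⁻¹ * (-c i) +
      algebraMap K R (w i)⁻¹ * (c i + algebraMap K R (w i) * x i) := by
    have : algebraMap K R (w i)⁻¹ * algebraMap K R (w i) = 1 := by
      rw [← map_mul, inv_mul_cancel₀ (hw i), map_one]
    linear_combination (-x i) * this
  rw [hxi]
  exact Submodule.add_mem_sup (Ideal.mul_mem_left _ _ (N.neg_mem (hc i)))
    (Ideal.mul_mem_left _ _ (h i))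

variable [DecidableEq ι]

/-- The leading correction, in units of `s ^ k`, to a solution near `ν`. -/
def correction (k : ℕ) (r : Finset ι → K) (ν : ι → K) (i : ι) : K :=
  (sepProd ν i)⁻¹ * ∑ M ∈ powersetCard k univ, r M * ∏ l ∈ Mᶜ, (ν i - ν l)

lemma eq_of_minorSum_eq {q : Finset ι → K} (hq : q ∅ = 1) {ν : ι → K}
    (hν : Function.Injective ν) {s : R} (hs : s ∈ maximalIdeal R) {x y : ι → R}
    (hx : ∀ i, x i - algebraMap K R (ν i) ∈ maximalIdeal R)
    (hy : ∀ i, y i - algebraMap K R (ν i) ∈ maximalIdeal R)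
    (hxy : ∀ i, minorSum s q x (algebraMap K R (ν i)) = minorSum s q y (algebraMap K R (ν i))) :
    x = y := by
  have h := span_le_of_mul_add_mem (N := (⊥ : Ideal R)) (x := fun i => x i - y i)
    (c := fun _ => 0) (sepProd_ne_zero hν) (fun _ => Ideal.zero_mem _) fun i => by
      have := minorSum_sub_add_mem hq ν hs hx hy
        (I := Ideal.span (Set.range fun i => x i - y i)) (fun i => Ideal.subset_span ⟨i, rfl⟩) i
      rwa [hxy i, sub_self] at this
  funext i
  exact sub_eq_zero.1 (by simpa using h (Ideal.subset_span ⟨i, rfl⟩))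

/-- A solution near `ν` agrees with `ν + s ^ k * correction` modulo higher order terms. -/
lemma exists_eq_add_correction {q a : Finset ι → K} (hq : q ∅ = 1) {k : ℕ}
    (hqa : ∀ M, #M < k → q M = a M) {ν : ι → K} (hν : Function.Injective ν) {s : R}
    (hs : s ∈ maximalIdeal R) {x : ι → R}
    (hx : ∀ i, x i - algebraMap K R (ν i) ∈ maximalIdeal R)
    (hsol : ∀ i, minorSum s q x (algebraMap K R (ν i)) =
      minorSum s a (fun l => algebraMap K R (ν l)) (algebraMap K R (ν i))) (i : ι) :
    ∃ j ∈ maximalIdeal R,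
      x i = algebraMap K R (ν i) + s ^ k * (algebraMap K R (correction k (q - a) ν i) + j) := by
  set c : ι → R := fun i =>
    minorSum s a (fun l => algebraMap K R (ν l)) (algebraMap K R (ν i)) -
      minorSum s q (fun l => algebraMap K R (ν l)) (algebraMap K R (ν i)) with hcdef
  set e : ι → K := fun i => ∑ M ∈ powersetCard k univ, (q M - a M) * ∏ l ∈ Mᶜ, (ν i - ν l)
  have hce : ∀ i, c i + s ^ k * algebraMap K R (e i) ∈ Ideal.span {s ^ k} * maximalIdeal R := by
    intro i
    have := Ideal.neg_mem_iff _ |>.2 (minorSum_sub_sub_mem hqa ν hs i)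
    convert this using 1
    simp only [hcdef, e]
    ring
  have hmem : ∀ i, c i + algebraMap K R (sepProd ν i) * (x i - algebraMap K R (ν i)) ∈
      maximalIdeal R * Ideal.span (Set.range fun i => x i - algebraMap K R (ν i)) := by
    intro i
    have := minorSum_sub_add_mem hq ν hs hx (y := fun i => algebraMap K R (ν i)) (by simp)
      (I := Ideal.span (Set.range fun i => x i - algebraMap K R (ν i)))
      (fun i => Ideal.subset_span ⟨i, rfl⟩) i
    rwa [hsol i] at this
  have hspan := span_le_of_mul_add_mem (N := Ideal.span {s ^ k}) (c := c) (sepProd_ne_zero hν)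
    (fun i => by
      have h2 := Ideal.mul_mem_right (algebraMap K R (e i)) _
        (Ideal.mem_span_singleton_self (s ^ k))
      simpa using Ideal.sub_mem _ (Ideal.mul_le_left (hce i)) h2) hmem
  have hfin := Ideal.sub_mem _ (Ideal.mul_mono_right hspan (hmem i))
    (by rw [mul_comm]; exact hce i)
  rw [mul_comm, Ideal.mem_span_singleton_mul] at hfin
  obtain ⟨j, hj, hj'⟩ := hfin
  refine ⟨algebraMap K R (sepProd ν i)⁻¹ * j, Ideal.mul_mem_left _ _ hj, ?_⟩
  have hinv : algebraMap K R (sepProd ν i)⁻¹ * algebraMap K R (sepProd ν i) = 1 := by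
    rw [← map_mul, inv_mul_cancel₀ (sepProd_ne_zero hν i), map_one]
  have hcor : algebraMap K R (correction k (q - a) ν i) =
      algebraMap K R (sepProd ν i)⁻¹ * algebraMap K R (e i) := by
    rw [← map_mul]; rfl
  rw [hcor]
  linear_combination (-(x i - algebraMap K R (ν i))) * hinv - algebraMap K R (sepProd ν i)⁻¹ * hj'

omit [Fintype ι] in
lemma exists_prod_eq_add {k : ℕ} (hk : k ≠ 0) {s : R} (hs : s ∈ maximalIdeal R) {ν δ : ι → K}
    {x : ι → R} (hx : ∀ i, ∃ j ∈ maximalIdeal R,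
      x i = algebraMap K R (ν i) + s ^ k * (algebraMap K R (δ i) + j)) (N : Finset ι) :
    ∃ j ∈ maximalIdeal R, ∏ i ∈ N, x i = algebraMap K R (∏ i ∈ N, ν i) +
      s ^ k * (algebraMap K R (∑ i ∈ N, δ i * ∏ l ∈ N.erase i, ν l) + j) := by
  induction N using Finset.induction_on with
  | empty => exact ⟨0, Ideal.zero_mem _, by simp⟩
  | insert b N hb ih =>
    obtain ⟨j, hj, hN⟩ := ih
    obtain ⟨j', hj', hb'⟩ := hx b
    have hsum : ∑ i ∈ insert b N, δ i * ∏ l ∈ (insert b N).erase i, ν l =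
        δ b * ∏ i ∈ N, ν i + ν b * ∑ i ∈ N, δ i * ∏ l ∈ N.erase i, ν l := by
      rw [Finset.sum_insert hb, Finset.erase_insert hb, Finset.mul_sum]
      congr 1
      refine Finset.sum_congr rfl fun i hi => ?_
      have hbi : b ≠ i := fun h => hb (h ▸ hi)
      rw [Finset.erase_insert_of_ne hbi,
        Finset.prod_insert (fun h => hb (Finset.mem_of_mem_erase h))]
      ring
    set T := ∑ i ∈ N, δ i * ∏ l ∈ N.erase i, ν l
    refine ⟨algebraMap K R (ν b) * j + algebraMap K R (∏ i ∈ N, ν i) * j' +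
      s ^ k * ((algebraMap K R (δ b) + j') * (algebraMap K R T + j)), ?_, ?_⟩
    · exact Ideal.add_mem _ (Ideal.add_mem _ (Ideal.mul_mem_left _ _ hj)
        (Ideal.mul_mem_left _ _ hj'))
        (Ideal.mul_mem_right _ _ (Ideal.pow_mem_of_mem _ hs _ (Nat.pos_of_ne_zero hk)))
    · rw [Finset.prod_insert hb, Finset.prod_insert hb, hsum, hN, hb']
      simp only [map_add, map_mul]
      ring

lemma exists_perm_residue {q a : Finset ι → K} (hq : q ∅ = 1) (ha : a ∅ = 1) {μ : ι → K}
    (hμ : Function.Injective μ) {s : R} (hs : s ∈ maximalIdeal R) {x : ι → R}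
    (hsol : ∀ z, minorSum s q x z = minorSum s a (fun l => algebraMap K R (μ l)) z) :
    ∃ σ : Equiv.Perm ι, ∀ i, x i - algebraMap K R (μ (σ i)) ∈ maximalIdeal R := by
  have hres : ∀ z, ∏ l, (residue R z - residue R (x l)) =
      ∏ l, (residue R z - residue R (algebraMap K R (μ l))) := by
    intro z
    have h := congrArg (IsScalarTower.toAlgHom K R (ResidueField R)) (hsol z)
    rw [map_minorSum, map_minorSum] at h
    simp only [IsScalarTower.toAlgHom_apply, ResidueField.algebraMap_eq,
      (residue_eq_zero_iff s).2 hs] at h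
    rwa [minorSum_zero_left hq, minorSum_zero_left ha] at h
  have h1 : ∀ i, ∃ l, residue R (x i) - residue R (algebraMap K R (μ l)) = 0 := fun i => by
    have h := hres (x i)
    rw [Finset.prod_eq_zero (Finset.mem_univ i) (sub_self _)] at h
    simpa using Finset.prod_eq_zero_iff.1 h.symm
  have h2 : ∀ l, ∃ i, residue R (algebraMap K R (μ l)) - residue R (x i) = 0 := fun l => by
    have h := hres (algebraMap K R (μ l))
    rw [Finset.prod_eq_zero (i := l) (f := fun j => residue R (algebraMap K R (μ l)) -
      residue R (algebraMap K R (μ j))) (Finset.mem_univ l) (sub_self _)] at h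
    simpa using Finset.prod_eq_zero_iff.1 h
  choose f hf using h1
  have hinj : Function.Injective fun l => residue R (algebraMap K R (μ l)) := fun l l' h =>
    hμ ((algebraMap K (ResidueField R)).injective h)
  have hsurj : Function.Surjective f := fun l => by
    obtain ⟨i, hi⟩ := h2 l
    refine ⟨i, hinj ?_⟩
    exact (sub_eq_zero.1 (hf i)).symm.trans (sub_eq_zero.1 hi).symm
  refine ⟨Equiv.ofBijective f (Finite.surjective_iff_bijective.1 hsurj), fun i => ?_⟩
  rw [← residue_eq_zero_iff, map_sub]
  exact hf i

end LocalRing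

section Symmetrization

variable {ι K : Type*} [Fintype ι] [DecidableEq ι] [Field K]

lemma sum_perm_eq_zero (hchar : ∀ m : ℕ, 0 < m → m ≤ Fintype.card ι → (m : K) ≠ 0) {μ : ι → K}
    (hμ : Function.Injective μ) {i : ι} {A B : Finset ι} {c : ℕ} (hA : i ∉ A) (hB : i ∉ B)
    (h : c + #(A ∩ B) < #B) :
    ∑ σ : Equiv.Perm ι, μ (σ i) ^ c * (∏ l ∈ A, μ (σ l)) / ∏ l ∈ B, (μ (σ i) - μ (σ l)) = 0 := by
  induction hn : #(A ∩ B) generalizing A B c with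
  | zero =>
    have hAB : A ∩ B = ∅ := Finset.card_eq_zero.1 hn
    have hswap : ∀ j ∈ insert i B,
        ∑ σ : Equiv.Perm ι, μ (σ i) ^ c * (∏ l ∈ A, μ (σ l)) / ∏ l ∈ B, (μ (σ i) - μ (σ l)) =
        ∑ σ : Equiv.Perm ι, (∏ l ∈ A, μ (σ l)) *
          (μ (σ j) ^ c / ∏ l ∈ (insert i B).erase j, (μ (σ j) - μ (σ l))) := by
      intro j hj
      refine Fintype.sum_equiv (Equiv.mulRight (Equiv.swap i j)) _ _ fun σ => ?_
      have hAprod : ∏ l ∈ A, μ ((σ * Equiv.swap i j) l) = ∏ l ∈ A, μ (σ l) := by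
        refine Finset.prod_congr rfl fun l hl => ?_
        have hli : l ≠ i := fun h => hA (h ▸ hl)
        have hlj : l ≠ j := by
          rintro rfl
          rcases Finset.mem_insert.1 hj with rfl | hj
          · exact hA hl
          · exact Finset.notMem_empty l (hAB ▸ Finset.mem_inter.2 ⟨hl, hj⟩)
        rw [Equiv.Perm.mul_apply, Equiv.swap_apply_of_ne_of_ne hli hlj]
      have hBprod : ∏ l ∈ B, (μ (σ i) - μ (σ l)) =
          ∏ l ∈ (insert i B).erase j, (μ (σ i) - μ ((σ * Equiv.swap i j) l)) := by
        refine Finset.prod_equiv (Equiv.swap i j) (fun l => ?_) fun l _ => by simp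
        rcases eq_or_ne l i with rfl | hli
        · simp [hB]
        · rcases eq_or_ne l j with rfl | hlj
          · simpa [hli, hli.symm] using hj
          · simp [Equiv.swap_apply_of_ne_of_ne hli hlj, hli, hlj]
      simp only [Equiv.coe_mulRight]
      rw [hAprod, hBprod, Equiv.Perm.mul_apply, Equiv.swap_apply_right]
      ring
    have hsum := Finset.sum_congr rfl hswap
    rw [Finset.sum_const, Finset.sum_comm, Finset.card_insert_of_notMem hB, nsmul_eq_mul] at hsum
    have hzero : ∀ σ : Equiv.Perm ι, ∑ j ∈ insert i B, (∏ l ∈ A, μ (σ l)) *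
        (μ (σ j) ^ c / ∏ l ∈ (insert i B).erase j, (μ (σ j) - μ (σ l))) = 0 := by
      intro σ
      have hinj : Set.InjOn (fun l => μ (σ l)) (insert i B : Finset ι) :=
        (hμ.comp σ.injective).injOn
      have hlt : c < #B := by omega
      have hcard := Finset.card_insert_of_notMem hB
      have hL := Lagrange.coeff_eq_sum hinj (P := (X : K[X]) ^ c) (by
        rw [degree_X_pow]; exact_mod_cast by omega)
      rw [coeff_X_pow, if_neg (by omega)] at hL
      simp only [eval_pow, eval_X] at hL
      rw [← Finset.mul_sum, ← hL, mul_zero]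
    rw [Finset.sum_congr rfl fun σ _ => hzero σ, Finset.sum_const_zero] at hsum
    refine (mul_eq_zero.1 hsum).resolve_left (hchar _ (Nat.succ_pos _) ?_)
    rw [← Finset.card_insert_of_notMem hB]
    exact Finset.card_le_univ _
  | succ m ih =>
    obtain ⟨a, ha⟩ := Finset.card_pos.1 (hn.symm ▸ Nat.succ_pos m : 0 < #(A ∩ B))
    obtain ⟨haA, haB⟩ := Finset.mem_inter.1 ha
    have hia : i ≠ a := fun h => hA (h ▸ haA)
    have h1 : #(A.erase a ∩ B) = m := by
      rw [Finset.erase_inter, Finset.card_erase_of_mem ha, hn, Nat.add_sub_cancel]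
    have h2 : #(A.erase a ∩ B.erase a) = m := by
      rw [Finset.inter_erase, Finset.erase_inter, Finset.erase_idem,
        Finset.card_erase_of_mem ha, hn, Nat.add_sub_cancel]
    have h3 := Finset.card_erase_of_mem haB
    have e1 := ih (A := A.erase a) (B := B) (c := c + 1) (fun h => hA (Finset.mem_of_mem_erase h))
      hB (by omega) h1
    have e2 := ih (A := A.erase a) (B := B.erase a) (c := c)
      (fun h => hA (Finset.mem_of_mem_erase h)) (fun h => hB (Finset.mem_of_mem_erase h))
      (by omega) h2
    refine Eq.trans ?_ ((congrArg₂ (· - ·) e1 e2).trans (sub_zero 0))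
    rw [← Finset.sum_sub_distrib]
    refine Finset.sum_congr rfl fun σ _ => ?_
    have hne : ∀ l ∈ B, μ (σ i) - μ (σ l) ≠ 0 := fun l hl => sub_ne_zero.2 fun h =>
      hB ((σ.injective (hμ h)) ▸ hl)
    have hP : ∏ l ∈ B.erase a, (μ (σ i) - μ (σ l)) ≠ 0 :=
      Finset.prod_ne_zero_iff.2 fun l hl => hne l (Finset.mem_of_mem_erase hl)
    rw [← Finset.mul_prod_erase _ _ haA, ← Finset.mul_prod_erase _ _ haB]
    have := hne a haB
    field_simp
    ring

lemma correction_eq (k : ℕ) (r : Finset ι → K) {ν : ι → K} (hν : Function.Injective ν) (i : ι) :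
    correction k r ν i = ∑ M ∈ powersetCard k univ,
      r M * if i ∈ M then (∏ l ∈ M.erase i, (ν i - ν l))⁻¹ else 0 := by
  rw [correction, Finset.mul_sum]
  refine Finset.sum_congr rfl fun M _ => ?_
  split_ifs with hi
  · have hw : sepProd ν i = (∏ l ∈ M.erase i, (ν i - ν l)) * ∏ l ∈ Mᶜ, (ν i - ν l) := by
      rw [sepProd, ← Finset.prod_union]
      · congr 1
        ext l
        by_cases hl : l ∈ M <;> simp [hl]
        rintro rfl
        exact hl hi
      · exact Finset.disjoint_left.2 fun l hl hl' =>
          Finset.mem_compl.1 hl' (Finset.mem_of_mem_erase hl)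
    have h0 := sepProd_ne_zero hν i
    rw [hw] at h0 ⊢
    have h1 := left_ne_zero_of_mul h0
    have h2 := right_ne_zero_of_mul h0
    field_simp
  · rw [Finset.prod_eq_zero (Finset.mem_compl.2 hi) (sub_self _)]
    ring

omit [Fintype ι] in
lemma sum_prod_erase_div {ν : ι → K} (hν : Function.Injective ν) {N : Finset ι}
    (hN : N.Nonempty) :
    ∑ i ∈ N, (∏ l ∈ N.erase i, (ν i - ν l))⁻¹ * ∏ l ∈ N.erase i, ν l = (-1) ^ (#N - 1) := by
  have h := congrArg (eval 0) (Lagrange.sum_basis (s := N) hν.injOn hN)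
  rw [eval_finsetSum, eval_one] at h
  refine Eq.trans ?_ ((congrArg ((-1) ^ (#N - 1) * ·) h).trans (mul_one _))
  rw [Finset.mul_sum]
  refine Finset.sum_congr rfl fun i hi => ?_
  rw [Lagrange.basis, eval_prod, ← Finset.card_erase_of_mem hi, ← Finset.prod_const,
    ← Finset.prod_mul_distrib, ← Finset.prod_inv_distrib, ← Finset.prod_mul_distrib]
  refine Finset.prod_congr rfl fun l _ => ?_
  simp [Lagrange.basisDivisor]

lemma sum_perm_correction (hchar : ∀ m : ℕ, 0 < m → m ≤ Fintype.card ι → (m : K) ≠ 0) {μ : ι → K}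
    (hμ : Function.Injective μ) (r : Finset ι → K) {N : Finset ι} (hN : N.Nonempty) :
    ∑ σ : Equiv.Perm ι, ∑ i ∈ N, correction #N r (fun l => μ (σ l)) i *
      ∏ l ∈ N.erase i, μ (σ l) = (-1) ^ (#N - 1) * (Fintype.card ι).factorial * r N := by
  have hσ : ∀ σ : Equiv.Perm ι, Function.Injective fun l => μ (σ l) := fun σ =>
    hμ.comp σ.injective
  simp_rw [fun σ : Equiv.Perm ι => correction_eq #N r (hσ σ), Finset.sum_mul]
  rw [Finset.sum_congr rfl fun σ _ => Finset.sum_comm, Finset.sum_comm,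
    Finset.sum_eq_single N]
  · have h : ∀ σ : Equiv.Perm ι, ∑ i ∈ N, (r N * if i ∈ N then
        (∏ l ∈ N.erase i, (μ (σ i) - μ (σ l)))⁻¹ else 0) * ∏ l ∈ N.erase i, μ (σ l) =
        r N * (-1) ^ (#N - 1) := by
      intro σ
      rw [← sum_prod_erase_div (hσ σ) hN, Finset.mul_sum]
      refine Finset.sum_congr rfl fun i hi => ?_
      rw [if_pos hi, mul_assoc]
    rw [Finset.sum_congr rfl fun σ _ => h σ, Finset.sum_const, Finset.card_univ,
      Fintype.card_perm, nsmul_eq_mul]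
    ring
  · intro M hM hMN
    have hcard := (Finset.mem_powersetCard.1 hM).2
    rw [Finset.sum_comm]
    refine Finset.sum_eq_zero fun i hi => ?_
    by_cases hiM : i ∈ M
    · have hlt : #(N ∩ M) < #N := Finset.card_lt_card <|
        Finset.inter_subset_left.ssubset_of_ne fun h => hMN <| Eq.symm <|
          Finset.eq_of_subset_of_card_le (Finset.inter_eq_left.1 h) hcard.le
      have hinter : #(N.erase i ∩ M.erase i) = #(N ∩ M) - 1 := by
        rw [Finset.inter_erase, Finset.erase_inter, Finset.erase_idem,
          Finset.card_erase_of_mem (Finset.mem_inter.2 ⟨hi, hiM⟩)]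
      have hpos := Finset.card_pos.2 ⟨i, Finset.mem_inter.2 ⟨hi, hiM⟩⟩
      have hM' := Finset.card_erase_of_mem hiM
      have h0 := sum_perm_eq_zero hchar hμ (c := 0) (Finset.notMem_erase i N)
        (Finset.notMem_erase i M) (by omega)
      rw [← mul_zero (r M), ← h0, Finset.mul_sum]
      refine Finset.sum_congr rfl fun σ _ => ?_
      rw [if_pos hiM]
      ring
    · simp [hiM]
  · intro h
    exact (h (by simp [Finset.mem_powersetCard])).elim

end Symmetrization

section Valuation

variable {K F : Type*} [Field K] [Field F] [Algebra K F]

lemma mem_range_of_forall_valuationSubring [IsAlgClosed K] {x : F}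
    (h : ∀ V : ValuationSubring F, (∀ c : K, algebraMap K F c ∈ V) → x ∈ V) :
    x ∈ (algebraMap K F).range := by
  by_contra hx
  have : IsIntegrallyClosedIn (⊥ : Subalgebra K F).toSubring F := by
    rw [Subring.isIntegrallyClosedIn_iff]
    intro y hy
    have hy' : IsIntegral (⊥ : Subalgebra K F) y := hy
    have hyK : IsIntegral K y := isIntegral_trans (A := (⊥ : Subalgebra K F)) y hy'
    exact minpoly.mem_range_of_degree_eq_one K y
      (IsAlgClosed.degree_eq_one_of_irreducible K (minpoly.irreducible hyK))
  obtain ⟨V, hV, hxV⟩ := Subring.exists_le_valuationSubring_of_isIntegrallyClosedIn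
    (R := (⊥ : Subalgebra K F).toSubring) (x := x) (fun h => hx h)
  exact hxV (h V fun c => hV ⟨c, rfl⟩)

lemma exists_valuationSubring_nonunit {t : F} (ht : Transcendental K t) :
    ∃ V : ValuationSubring F, (∀ c : K, algebraMap K F c ∈ V) ∧ t ∈ V.nonunits := by
  let A := (Algebra.adjoin K {t}).toSubring
  let t' : A := ⟨t, Algebra.subset_adjoin rfl⟩
  have hI : Ideal.span {t'} ≠ ⊤ := by
    rw [Ne, Ideal.span_singleton_eq_top]
    rintro hu
    obtain ⟨⟨b, hb⟩, hbt⟩ := hu.exists_right_inv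
    obtain ⟨p, rfl⟩ := Algebra.adjoin_mem_exists_aeval K t hb
    have h1 : t * aeval t p = 1 := congrArg Subtype.val hbt
    have h2 : aeval t (X * p - 1) = 0 := by simp [h1]
    have h3 := (transcendental_iff.1 ht) _ h2
    simpa using congrArg (coeff · 0) h3
  obtain ⟨V, hV, hVt⟩ := Ideal.image_subset_nonunits_valuationSubring _ hI
  exact ⟨V, fun c => hV ((Algebra.adjoin K {t}).algebraMap_mem c),
    hVt ⟨t', Ideal.mem_span_singleton_self _, rfl⟩⟩

/-- The algebra structure on a valuation subring containing the base field. -/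
abbrev ValuationSubring.algebraOfMem (V : ValuationSubring F)
    (hV : ∀ c : K, algebraMap K F c ∈ V) : Algebra K V :=
  ((algebraMap K F).codRestrict V.toSubring hV).toAlgebra

end Valuation

section Bounded

variable {ι K F : Type*} [Fintype ι] [DecidableEq ι] [Field K] [Field F] [Algebra K F]

open IsLocalRing

lemma mem_of_minorSum_eq {q a : Finset ι → K} (hq : q ∅ = 1) (ha : a ∅ = 1)
    {V : ValuationSubring F} (hV : ∀ c : K, algebraMap K F c ∈ V) {s : F} (hs : s ∈ V)
    {v y : ι → F} (hv : ∀ i, v i ∈ V) (h : ∀ z, minorSum s q y z = minorSum s a v z) (l : ι) :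
    y l ∈ V := by
  let algKV : Algebra K V := V.algebraOfMem hV
  have : IsScalarTower K V F := IsScalarTower.of_algebraMap_eq fun _ => rfl
  by_contra hl
  obtain ⟨b, -, hb⟩ := Finset.exists_max_image univ (fun i => V.valuation (y i)) ⟨l, mem_univ l⟩
  have hyb : 1 < V.valuation (y b) := lt_of_lt_of_le
    (lt_of_not_ge fun h => hl ((V.valuation_le_one_iff _).1 h)) (hb l (mem_univ l))
  have hb0 : y b ≠ 0 := fun h => by simp [h] at hyb
  have hpos : 0 < V.valuation (y b) := zero_lt_one.trans hyb
  have hu : V.valuation (y b)⁻¹ < 1 := by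
    rw [map_inv₀]
    exact inv_lt_one_of_one_lt₀ hyb
  have hy' : ∀ i, (y b)⁻¹ * y i ∈ V := fun i => by
    rw [← V.valuation_le_one_iff, map_mul, map_inv₀]
    exact inv_mul_le_one_of_le₀ (hb i (mem_univ i)) zero_le
  let u : V := ⟨(y b)⁻¹, (V.valuation_le_one_iff _).1 hu.le⟩
  let s' : V := ⟨s, hs⟩
  let v' : ι → V := fun i => ⟨v i, hv i⟩
  let y' : ι → V := fun i => ⟨(y b)⁻¹ * y i, hy' i⟩
  have hum : u ∈ maximalIdeal V := (V.valuation_lt_one_iff u).2 hu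
  have hV1 : minorSum (u * s') q y' 1 = minorSum (u * s') a (fun i => u * v' i) 1 := by
    apply Subtype.val_injective
    have h1 := map_minorSum (IsScalarTower.toAlgHom K V F) (u * s') q y' 1
    have h2 := map_minorSum (IsScalarTower.toAlgHom K V F) (u * s') a (fun i => u * v' i) 1
    refine h1.trans (Eq.trans ?_ h2.symm)
    have e1 := minorSum_scale (y b)⁻¹ s q y (y b)
    have e2 := minorSum_scale (y b)⁻¹ s a v (y b)
    rw [inv_mul_cancel₀ hb0] at e1 e2
    rw [map_one]
    exact e1.trans ((congrArg _ (h _)).trans e2.symm)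
  have hres := congrArg (IsScalarTower.toAlgHom K V (ResidueField V)) hV1
  rw [map_minorSum, map_minorSum] at hres
  simp only [IsScalarTower.toAlgHom_apply, ResidueField.algebraMap_eq, map_mul,
    (residue_eq_zero_iff u).2 hum, zero_mul, map_one] at hres
  rw [minorSum_zero_left hq, minorSum_zero_left ha] at hres
  have hy1 : y' b = 1 := Subtype.ext (inv_mul_cancel₀ hb0)
  rw [Finset.prod_eq_zero (mem_univ b) (by rw [hy1, map_one, sub_self])] at hres
  simp at hres

end Bounded

section Interpolation

variable {ι K R : Type*} [Fintype ι] [DecidableEq ι] [Field K] [CommRing R] [IsDomain R]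
  [Algebra K R]

omit [IsDomain R] in
lemma eval_minorSum (s : R) (q : Finset ι → K) (x : ι → R) (z : R) :
    (minorSum (C s) q (fun i => C (x i)) X).eval z = minorSum s q x z := by
  have h := map_minorSum ((aeval z : R[X] →ₐ[R] R).restrictScalars K) (C s) q
    (fun i => C (x i)) X
  simpa [coe_aeval_eq_eval] using h

lemma degree_minorSum_sub_lt {q : Finset ι → K} (hq : q ∅ = 1) (s : R) (x : ι → R) :
    (minorSum (C s) q (fun i => C (x i)) X - ∏ l, (X - C (x l))).degree <
      (Fintype.card ι : WithBot ℕ) := by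
  rw [minorSum, ← Finset.add_sum_erase _ _ (Finset.mem_univ ∅)]
  simp only [hq, map_one, Finset.card_empty, pow_zero, one_mul, Finset.compl_empty,
    add_sub_cancel_left]
  refine (degree_sum_le _ _).trans_lt ((Finset.sup_lt_iff (WithBot.bot_lt_coe _)).2 fun M hM => ?_)
  have hM0 : M.Nonempty := Finset.nonempty_iff_ne_empty.2 (Finset.ne_of_mem_erase hM)
  rw [IsScalarTower.algebraMap_apply K R R[X], ← C_pow, algebraMap_eq, ← C_mul]
  rw [← smul_eq_C_mul]
  refine (degree_smul_le _ _).trans_lt ?_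
  rw [degree_prod, Finset.sum_congr rfl fun l _ => degree_X_sub_C (x l), Finset.sum_const,
    nsmul_one]
  exact_mod_cast (Finset.card_compl_lt_iff_nonempty M).2 hM0

/-- Two families of solutions agreeing at `card ι` points agree everywhere. -/
lemma minorSum_eq_of_eq_at {q a : Finset ι → K} (hq : q ∅ = 1) (ha : a ∅ = 1) {s : R}
    {x v c : ι → R} (hc : Function.Injective c)
    (h : ∀ i, minorSum s q x (c i) = minorSum s a v (c i)) (z : R) :
    minorSum s q x z = minorSum s a v z := by
  rw [← eval_minorSum s q x, ← eval_minorSum s a v]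
  congr 1
  refine eq_of_degree_sub_lt_of_eval_index_eq univ hc.injOn ?_ fun i _ => by
    rw [eval_minorSum, eval_minorSum, h i]
  have h1 := degree_minorSum_sub_lt hq s x
  have h2 := degree_minorSum_sub_lt ha s v
  have h3 : (∏ l, (X - C (x l)) - ∏ l, (X - C (v l))).degree < (Fintype.card ι : WithBot ℕ) := by
    have hd : ∀ x : ι → R, (∏ l, (X - C (x l))).degree = (Fintype.card ι : WithBot ℕ) :=
      fun x => by simp [degree_prod]
    rw [← hd x]
    refine degree_sub_lt_left ((hd x).trans (hd v).symm) ?_ ?_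
    · exact (monic_prod_of_monic _ _ fun l _ => monic_X_sub_C _).ne_zero
    · rw [(monic_prod_of_monic _ _ fun l _ => monic_X_sub_C _).leadingCoeff,
        (monic_prod_of_monic _ _ fun l _ => monic_X_sub_C _).leadingCoeff]
  have h4 := (degree_sub_le _ _).trans_lt (max_lt ((degree_add_le _ _).trans_lt (max_lt h1 h3)) h2)
  rw [Finset.card_univ]
  convert h4 using 1
  exact congrArg degree (by ring)

end Interpolation

section Newton

variable {ι K : Type*} [Fintype ι] [DecidableEq ι] [Field K]

lemma PowerSeries.exists_limit {x : ℕ → PowerSeries K}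
    (h : ∀ m, x (m + 1) - x m ∈ Ideal.span {(PowerSeries.X : PowerSeries K) ^ (m + 1)}) :
    ∃ y, ∀ m, y - x m ∈ Ideal.span {(PowerSeries.X : PowerSeries K) ^ (m + 1)} := by
  simp only [Ideal.mem_span_singleton, PowerSeries.X_pow_dvd_iff, map_sub, sub_eq_zero] at h ⊢
  have hs : ∀ j e, PowerSeries.coeff j (x (j + e)) = PowerSeries.coeff j (x j) := fun j e => by
    induction e with
    | zero => rfl
    | succ e ih => rw [← ih, ← add_assoc, h (j + e) j (by omega)]
  refine ⟨PowerSeries.mk fun j => PowerSeries.coeff j (x j), fun m j hj => ?_⟩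
  obtain ⟨e, rfl⟩ := Nat.exists_eq_add_of_le (Nat.lt_succ_iff.1 hj)
  rw [PowerSeries.coeff_mk, hs]

variable {R : Type*} [CommRing R] [Algebra K R]

lemma exists_newton_seq {q a : Finset ι → K} (hq : q ∅ = 1) (ha : a ∅ = 1) {ν : ι → K}
    (hν : Function.Injective ν) {J : Ideal R} {s : R} (hs : s ∈ J) :
    ∃ x : ℕ → ι → R, ∀ m i, x m i - algebraMap K R (ν i) ∈ J ∧ x (m + 1) i - x m i ∈ J ^ (m + 1) ∧
      minorSum s q (x m) (algebraMap K R (ν i)) -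
        minorSum s a (fun l => algebraMap K R (ν l)) (algebraMap K R (ν i)) =
      algebraMap K R (sepProd ν i) * (x (m + 1) i - x m i) := by
  obtain ⟨f, hf⟩ : ∃ f : (ι → R) → ι → R, ∀ x i, f x i =
    minorSum s q x (algebraMap K R (ν i)) := ⟨_, fun _ _ => rfl⟩
  obtain ⟨g, hg⟩ : ∃ g : ι → R, ∀ i, g i =
    minorSum s a (fun l => algebraMap K R (ν l)) (algebraMap K R (ν i)) := ⟨_, fun _ => rfl⟩
  obtain ⟨w, hw⟩ : ∃ w : ι → R, ∀ i, w i = algebraMap K R (sepProd ν i) := ⟨_, fun _ => rfl⟩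
  obtain ⟨w', hw'⟩ : ∃ w' : ι → R, ∀ i, w' i * w i = 1 :=
    ⟨fun i => algebraMap K R (sepProd ν i)⁻¹, fun i => by
      rw [hw, ← map_mul, inv_mul_cancel₀ (sepProd_ne_zero hν i), map_one]⟩
  obtain ⟨x, hx0, hxs⟩ : ∃ x : ℕ → ι → R, (∀ i, x 0 i = algebraMap K R (ν i)) ∧
      ∀ m i, x (m + 1) i = x m i + w' i * (f (x m) i - g i) :=
    ⟨fun m => (fun x i => x i + w' i * (f x i - g i))^[m] fun i => algebraMap K R (ν i),
      fun _ => rfl, fun m i => by simp only [Function.iterate_succ_apply']⟩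
  have hfg : ∀ m i, f (x m) i - g i = w i * (x (m + 1) i - x m i) := fun m i => by
    linear_combination -(f (x m) i - g i) * hw' i - w i * hxs m i
  have key : ∀ m, (∀ i, x m i - algebraMap K R (ν i) ∈ J) ∧
      ∀ i, x (m + 1) i - x m i ∈ J ^ (m + 1) := by
    intro m
    induction m with
    | zero =>
      refine ⟨fun i => by simp [hx0], fun i => ?_⟩
      have h1 := minorSum_sub_sub_mem (q := q) (a := a) (k := 1) (fun M hM => by
        rw [Finset.card_eq_zero.1 (Nat.lt_one_iff.1 hM), hq, ha]) ν hs i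
      have h2 := Ideal.mul_le_right h1
      rw [hxs, add_sub_cancel_left, zero_add, pow_one]
      refine Ideal.mul_mem_left _ _ ?_
      rw [hf, hg, funext hx0]
      refine (Submodule.sub_mem_iff_left _ ?_).1 h2
      exact Ideal.mul_mem_right _ _ (by rwa [pow_one])
    | succ m ih =>
      have hJ' : ∀ i, x (m + 1) i - algebraMap K R (ν i) ∈ J := fun i => by
        have := J.add_mem (Ideal.pow_le_self (Nat.succ_ne_zero m) (ih.2 i)) (ih.1 i)
        rwa [sub_add_sub_cancel] at this
      refine ⟨hJ', fun i => ?_⟩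
      have h1 := minorSum_sub_add_mem hq ν hs hJ' ih.1 ih.2 i
      rw [← pow_succ', ← hf, ← hf, ← hw] at h1
      have h2 := Ideal.mul_mem_left _ (w' i) h1
      convert h2 using 1
      linear_combination (-(x (m + 1 + 1) i - x (m + 1) i)) * hw' i - w' i * hfg (m + 1) i +
        w' i * hfg m i
  exact ⟨x, fun m i => ⟨(key m).1 i, (key m).2 i, by rw [← hf, ← hg, ← hw, hfg]⟩⟩

/-- Solutions near `ν` over power series, by Newton iteration. -/
lemma exists_minorSum_eq {q a : Finset ι → K} (hq : q ∅ = 1) (ha : a ∅ = 1) {ν : ι → K}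
    (hν : Function.Injective ν) :
    ∃ x : ι → PowerSeries K,
      (∀ i, x i - algebraMap K _ (ν i) ∈ Ideal.span {(PowerSeries.X : PowerSeries K)}) ∧
      ∀ i, minorSum PowerSeries.X q x (algebraMap K _ (ν i)) =
        minorSum PowerSeries.X a (fun l => algebraMap K _ (ν l)) (algebraMap K _ (ν i)) := by
  have hs := Ideal.mem_span_singleton_self (PowerSeries.X : PowerSeries K)
  obtain ⟨x, hx⟩ := exists_newton_seq hq ha hν hs
  have hJ : ∀ m, Ideal.span {(PowerSeries.X : PowerSeries K) ^ m} =
    Ideal.span {PowerSeries.X} ^ m := fun m => (Ideal.span_singleton_pow _ _).symm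
  choose y hy using fun i => PowerSeries.exists_limit (x := fun m => x m i) fun m => by
    rw [hJ]
    exact (hx m i).2.1
  have hyJ : ∀ i, y i - algebraMap K _ (ν i) ∈
      Ideal.span {(PowerSeries.X : PowerSeries K)} := fun i => by
    have h1 := hy i 0
    rw [zero_add, pow_one] at h1
    have := Ideal.add_mem _ h1 (hx 0 i).1
    rwa [sub_add_sub_cancel] at this
  refine ⟨y, hyJ, fun i => ?_⟩
  have hmem : ∀ m, minorSum PowerSeries.X q y (algebraMap K _ (ν i)) -
      minorSum PowerSeries.X a (fun l => algebraMap K _ (ν l)) (algebraMap K _ (ν i)) ∈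
      Ideal.span {(PowerSeries.X : PowerSeries K) ^ (m + 1)} := fun m => by
    have h1 := minorSum_sub_add_mem hq ν hs hyJ (fun i => (hx m i).1) (fun i => hy i m) i
    have h2 := Ideal.mul_mem_left _ (algebraMap K (PowerSeries K) (sepProd ν i))
      (Ideal.sub_mem _ (hJ (m + 1) ▸ (hx m i).2.1) (hy i m))
    have h3 := Ideal.add_mem _ (Ideal.mul_le_right h1) h2
    convert h3 using 1
    linear_combination (hx m i).2.2
  rw [← sub_eq_zero]
  ext j
  exact (PowerSeries.X_pow_dvd_iff.1 (Ideal.mem_span_singleton.1 (hmem j))) j (Nat.lt_succ_self j)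

end Newton

section Main

variable {ι K R : Type*} [Fintype ι] [DecidableEq ι] [Field K] [CommRing R] [IsLocalRing R]
  [Algebra K R]

open IsLocalRing

/-- The sum of `∏ i ∈ N, x i` over `n!` distinct solutions, up to higher order terms. -/
lemma exists_sum_prod_eq_add (hchar : ∀ m : ℕ, 0 < m → m ≤ Fintype.card ι → (m : K) ≠ 0)
    {q a : Finset ι → K} (hq : q ∅ = 1) (ha : a ∅ = 1) (haa : ∀ M N, #M = #N → a M = a N)
    {N : Finset ι} (hN : N.Nonempty) (hqa : ∀ M, #M < #N → q M = a M) {μ : ι → K}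
    (hμ : Function.Injective μ) {s : R} (hs : s ∈ maximalIdeal R) {x : Equiv.Perm ι → ι → R}
    (hx : Function.Injective x)
    (hsol : ∀ σ z, minorSum s q (x σ) z = minorSum s a (fun l => algebraMap K R (μ l)) z) :
    ∃ j ∈ maximalIdeal R, ∑ σ, ∏ i ∈ N, x σ i =
      algebraMap K R (∑ σ : Equiv.Perm ι, ∏ i ∈ N, μ (σ i)) + s ^ #N * (algebraMap K R
        ((-1) ^ (#N - 1) * (Fintype.card ι).factorial * (q N - a N)) + j) := by
  choose ρ hρ using fun σ => exists_perm_residue hq ha hμ hs (hsol σ)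
  have hinj : Function.Injective ρ := fun σ τ h => hx <|
    eq_of_minorSum_eq (ν := μ ∘ ρ σ) hq (hμ.comp (ρ σ).injective) hs (hρ σ)
      (by rw [h]; exact hρ τ) fun i => by rw [hsol, hsol]
  have hprod : ∀ σ, ∃ j ∈ maximalIdeal R, ∏ i ∈ N, x σ i =
      algebraMap K R (∏ i ∈ N, μ (ρ σ i)) + s ^ #N * (algebraMap K R (∑ i ∈ N,
        correction #N (q - a) (fun l => μ (ρ σ l)) i * ∏ l ∈ N.erase i, μ (ρ σ l)) + j) := by
    intro σ
    refine exists_prod_eq_add (Finset.card_pos.2 hN).ne' hs (ν := fun l => μ (ρ σ l))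
      (fun i => ?_) N
    refine exists_eq_add_correction hq hqa (hμ.comp (ρ σ).injective) hs (hρ σ) (fun i => ?_) i
    rw [hsol]
    exact (minorSum_comp_perm s haa (ρ σ) (fun l => algebraMap K R (μ l)) _).symm
  choose j hj hj' using hprod
  refine ⟨∑ σ, j σ, Ideal.sum_mem _ fun σ _ => hj σ, ?_⟩
  have hbij : Function.Bijective ρ := Finite.injective_iff_bijective.1 hinj
  have hsum : ∀ G : Equiv.Perm ι → K, ∑ σ, G (ρ σ) = ∑ σ, G σ := fun G => hbij.sum_comp G
  have hγ := sum_perm_correction hchar hμ (q - a) hN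
  rw [Finset.sum_congr rfl fun σ _ => hj' σ, Finset.sum_add_distrib, ← map_sum,
    hsum fun τ => ∏ i ∈ N, μ (τ i), ← Finset.mul_sum, Finset.sum_add_distrib, ← map_sum,
    hsum fun τ => ∑ i ∈ N, correction #N (q - a) (fun l => μ (τ l)) i * ∏ l ∈ N.erase i, μ (τ l),
    hγ, Pi.sub_apply]

end Main

lemma natCast_factorial_ne_zero {K : Type*} [Field K] {n : ℕ}
    (h : ∀ m : ℕ, 0 < m → m ≤ n → (m : K) ≠ 0) : (n.factorial : K) ≠ 0 := by
  rw [← Finset.prod_range_add_one_eq_factorial, Nat.cast_prod]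
  exact Finset.prod_ne_zero_iff.2 fun m hm => h _ (Nat.succ_pos _) (Finset.mem_range.1 hm)

section Solutions

variable {ι K : Type*} [Fintype ι] [DecidableEq ι] [Field K]

lemma PowerSeries.transcendental_X : Transcendental K (PowerSeries.X : PowerSeries K) := by
  rw [transcendental_iff]
  intro p hp
  rw [Polynomial.aeval_def, PowerSeries.algebraMap_eq, Polynomial.eval₂_C_X_eq_coe] at hp
  exact (Polynomial.coe_eq_zero_iff).1 hp

/-- Over the field of Laurent series there are `n!` distinct solutions. -/
lemma exists_transcendental_family {q a : Finset ι → K} (hq : q ∅ = 1) (ha : a ∅ = 1)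
    (haa : ∀ M N, #M = #N → a M = a N) {μ : ι → K} (hμ : Function.Injective μ) :
    ∃ s : FractionRing (PowerSeries K), Transcendental K s ∧
      ∃ x : Equiv.Perm ι → ι → FractionRing (PowerSeries K), Function.Injective x ∧
        ∀ σ z, minorSum s q (x σ) z = minorSum s a (fun l => algebraMap K _ (μ l)) z := by
  have hφ := IsFractionRing.injective (PowerSeries K) (FractionRing (PowerSeries K))
  choose x hxX hx using fun σ : Equiv.Perm ι =>
    exists_minorSum_eq hq ha (ν := μ ∘ σ) (hμ.comp σ.injective)
  refine ⟨algebraMap (PowerSeries K) _ PowerSeries.X,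
    (transcendental_algebraMap_iff hφ).2 PowerSeries.transcendental_X,
    fun σ i => algebraMap (PowerSeries K) _ (x σ i), fun σ τ h => ?_, fun σ z => ?_⟩
  · refine Equiv.ext fun i => hμ ?_
    have hi : x σ i = x τ i := hφ (congrFun h i)
    have h1 := Ideal.sub_mem _ (hxX τ i) (hi ▸ hxX σ i)
    rw [sub_sub_sub_cancel_left, Ideal.mem_span_singleton, PowerSeries.X_dvd_iff, map_sub,
      PowerSeries.algebraMap_eq, PowerSeries.constantCoeff_C, PowerSeries.constantCoeff_C] at h1
    exact sub_eq_zero.1 h1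
  · refine minorSum_eq_of_eq_at hq ha (c := fun i => algebraMap K _ (μ (σ i)))
      ((algebraMap K _).injective.comp (hμ.comp σ.injective)) (fun i => ?_) z
    have h1 := congrArg (IsScalarTower.toAlgHom K (PowerSeries K)
      (FractionRing (PowerSeries K))) (hx σ i)
    rw [map_minorSum, map_minorSum] at h1
    simp only [AlgHom.commutes, Function.comp_apply, IsScalarTower.toAlgHom_apply] at h1
    rw [h1]
    exact minorSum_comp_perm _ haa σ (fun l => algebraMap K _ (μ l)) _

end Solutions

section ValuationSubring

variable {ι K F : Type*} [Fintype ι] [DecidableEq ι] [Field K] [Field F] [Algebra K F]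

open IsLocalRing

lemma sub_mem_nonunits (hchar : ∀ m : ℕ, 0 < m → m ≤ Fintype.card ι → (m : K) ≠ 0)
    {q a : Finset ι → K} (hq : q ∅ = 1) (ha : a ∅ = 1) (haa : ∀ M N, #M = #N → a M = a N)
    {N : Finset ι} (hN : N.Nonempty) (hqa : ∀ M, #M < #N → q M = a M) {μ : ι → K}
    (hμ : Function.Injective μ) {s : F} (hs0 : s ≠ 0) {x : Equiv.Perm ι → ι → F}
    (hx : Function.Injective x)
    (hsol : ∀ σ z, minorSum s q (x σ) z = minorSum s a (fun l => algebraMap K F (μ l)) z)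
    {V : ValuationSubring F} (hV : ∀ c : K, algebraMap K F c ∈ V) (hs : s ∈ V.nonunits) :
    (s⁻¹) ^ #N * (∑ σ, ∏ i ∈ N, x σ i -
      algebraMap K F (∑ σ : Equiv.Perm ι, ∏ i ∈ N, μ (σ i))) -
      algebraMap K F ((-1) ^ (#N - 1) * (Fintype.card ι).factorial * (q N - a N)) ∈
      V.nonunits := by
  let algKV : Algebra K V := V.algebraOfMem hV
  have : IsScalarTower K V F := IsScalarTower.of_algebraMap_eq fun _ => rfl
  lift s to V using V.nonunits_le hs
  have hs' := ValuationSubring.coe_mem_nonunits_iff.1 hs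
  have hxV : ∀ σ i, x σ i ∈ V := fun σ i =>
    mem_of_minorSum_eq hq ha hV s.2 (fun l => hV (μ l)) (hsol σ) i
  lift x to Equiv.Perm ι → ι → V using hxV
  have hsol' : ∀ σ z, minorSum s q (x σ) z = minorSum s a (fun l => algebraMap K V (μ l)) z :=
    fun σ z => by
      apply Subtype.val_injective
      have h1 := map_minorSum (IsScalarTower.toAlgHom K V F) s q (x σ) z
      have h2 := map_minorSum (IsScalarTower.toAlgHom K V F) s a
        (fun l => algebraMap K V (μ l)) z
      exact h1.trans ((hsol σ z).trans h2.symm)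
  obtain ⟨j, hj, hj'⟩ := exists_sum_prod_eq_add hchar hq ha haa hN hqa hμ hs'
    (fun σ τ h => hx (by simp only [h])) hsol'
  generalize (-1) ^ (#N - 1) * ((Fintype.card ι).factorial : K) * (q N - a N) = γ at hj' ⊢
  generalize ∑ σ : Equiv.Perm ι, ∏ i ∈ N, μ (σ i) = T at hj' ⊢
  have hj'' := congrArg (IsScalarTower.toAlgHom K V F) hj'
  simp only [map_add, map_mul, map_pow, AlgHom.commutes, map_sum, map_prod] at hj''
  convert ValuationSubring.coe_mem_nonunits_iff.2 hj using 1
  refine (congrArg (fun S => (s : F)⁻¹ ^ #N * (S - algebraMap K F T) - algebraMap K F γ)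
    hj'').trans ?_
  rw [add_sub_cancel_left, inv_pow]
  exact (congrArg (· - _) (inv_mul_cancel_left₀ (pow_ne_zero _ hs0) _)).trans
    (add_sub_cancel_left _ _)

lemma mem_nonunits_of_minorSum_eq [IsAlgClosed K] {q a : Finset ι → K} (hq : q ∅ = 1)
    (ha : a ∅ = 1) (h0 : ∀ d : ι → K, (∀ z, minorSum 1 q d z = minorSum (1 : K) a 0 z) → d = 0)
    {V : ValuationSubring F} (hV : ∀ c : K, algebraMap K F c ∈ V) {v y : ι → F}
    (hv : ∀ i, v i ∈ V.nonunits) (h : ∀ z, minorSum 1 q y z = minorSum 1 a v z) (i : ι) :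
    y i ∈ V.nonunits := by
  let algKV : Algebra K V := V.algebraOfMem hV
  have : IsScalarTower K V F := IsScalarTower.of_algebraMap_eq fun _ => rfl
  have hyV : ∀ i, y i ∈ V := mem_of_minorSum_eq hq ha hV V.one_mem
    (fun i => V.nonunits_le (hv i)) h
  lift y to ι → V using hyV
  lift v to ι → V using fun i => V.nonunits_le (hv i)
  simp only [ValuationSubring.coe_mem_nonunits_iff] at hv ⊢
  have hres : ∀ z, minorSum 1 q (fun i => residue V (y i)) z = minorSum 1 a 0 z := by
    intro z
    obtain ⟨z, rfl⟩ := residue_surjective z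
    have h1 : minorSum 1 q y z = minorSum 1 a v z := by
      apply Subtype.val_injective
      have h1 := map_minorSum (IsScalarTower.toAlgHom K V F) 1 q y z
      have h2 := map_minorSum (IsScalarTower.toAlgHom K V F) 1 a v z
      rw [map_one] at h1 h2
      exact h1.trans ((h z).trans h2.symm)
    have h2 := congrArg (IsScalarTower.toAlgHom K V (ResidueField V)) h1
    rw [map_minorSum, map_minorSum, map_one] at h2
    simp only [IsScalarTower.toAlgHom_apply, ResidueField.algebraMap_eq,
      fun i => (residue_eq_zero_iff (v i)).2 (hv i)] at h2
    exact h2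
  have hrange : ∀ i, residue V (y i) ∈ (algebraMap K (ResidueField V)).range := fun i =>
    mem_range_of_forall_valuationSubring fun W hW =>
      mem_of_minorSum_eq hq ha hW W.one_mem (fun _ => W.zero_mem) hres i
  choose d hd using hrange
  have hd0 : d = 0 := h0 d fun z => by
    apply (algebraMap K (ResidueField V)).injective
    have h1 := map_minorSum (Algebra.ofId K (ResidueField V)) 1 q d z
    have h2 := map_minorSum (Algebra.ofId K (ResidueField V)) 1 a 0 z
    simp only [Algebra.ofId_apply, map_one, hd, Pi.zero_apply, map_zero] at h1 h2
    exact h1.trans ((hres _).trans h2.symm)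
  rw [← residue_eq_zero_iff, ← hd, hd0, Pi.zero_apply, map_zero]

lemma apply_eq_of_family [IsAlgClosed K]
    (hchar : ∀ m : ℕ, 0 < m → m ≤ Fintype.card ι → (m : K) ≠ 0)
    {q a : Finset ι → K} (hq : q ∅ = 1) (ha : a ∅ = 1) (haa : ∀ M N, #M = #N → a M = a N)
    (h0 : ∀ d : ι → K, (∀ z, minorSum 1 q d z = minorSum (1 : K) a 0 z) → d = 0)
    {N : Finset ι} (hN : N.Nonempty) (hqa : ∀ M, #M < #N → q M = a M) {μ : ι → K}
    (hμ : Function.Injective μ) {s : F} (hs : Transcendental K s) {x : Equiv.Perm ι → ι → F}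
    (hx : Function.Injective x)
    (hsol : ∀ σ z, minorSum s q (x σ) z = minorSum s a (fun l => algebraMap K F (μ l)) z) :
    q N = a N := by
  have hs0 : s ≠ 0 := fun h => hs (h ▸ isAlgebraic_zero)
  have ht : Transcendental K s⁻¹ := fun h => hs (IsAlgebraic.inv_iff.1 h)
  have hsol' : ∀ σ z, minorSum 1 q (fun i => s⁻¹ * x σ i) z =
      minorSum 1 a (fun l => s⁻¹ * algebraMap K F (μ l)) z := fun σ z => by
    have h1 := minorSum_scale s⁻¹ s q (x σ) (s * z)
    have h2 := minorSum_scale s⁻¹ s a (fun l => algebraMap K F (μ l)) (s * z)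
    rw [inv_mul_cancel_left₀ hs0, inv_mul_cancel₀ hs0] at h1 h2
    rw [h1, h2, hsol]
  set γ : K := (-1) ^ (#N - 1) * (Fintype.card ι).factorial * (q N - a N) with hγ
  obtain ⟨h, hh⟩ : ∃ h, h = (s⁻¹) ^ #N * (∑ σ, ∏ i ∈ N, x σ i -
      algebraMap K F (∑ σ : Equiv.Perm ι, ∏ i ∈ N, μ (σ i))) := ⟨_, rfl⟩
  have hh' : h = ∑ σ, ∏ i ∈ N, s⁻¹ * x σ i -
      ∑ σ : Equiv.Perm ι, ∏ i ∈ N, s⁻¹ * algebraMap K F (μ (σ i)) := by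
    simp only [hh, Finset.prod_mul_distrib, Finset.prod_const, ← Finset.mul_sum, mul_sub, map_sum,
      map_prod]
  have hmemS : ∀ V : ValuationSubring F, (∀ c : K, algebraMap K F c ∈ V) → s ∈ V.nonunits →
      h - algebraMap K F γ ∈ V.nonunits := fun V hV hsV =>
    hh ▸ sub_mem_nonunits hchar hq ha haa hN hqa hμ hs0 hx hsol hV hsV
  have hmemT : ∀ V : ValuationSubring F, (∀ c : K, algebraMap K F c ∈ V) → s⁻¹ ∈ V → h ∈ V := by
    intro V hV htV
    have hμV : ∀ l, s⁻¹ * algebraMap K F (μ l) ∈ V := fun l => V.mul_mem _ _ htV (hV _)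
    rw [hh']
    exact sub_mem
      (sum_mem fun σ _ => prod_mem fun i _ =>
        mem_of_minorSum_eq hq ha hV V.one_mem hμV (hsol' σ) i)
      (sum_mem fun σ _ => prod_mem fun i _ => hμV (σ i))
  obtain ⟨c, hc⟩ : h ∈ (algebraMap K F).range := by
    refine mem_range_of_forall_valuationSubring fun V hV => ?_
    by_cases htV : s⁻¹ ∈ V
    · exact hmemT V hV htV
    · have h1 := hmemS V hV ((ValuationSubring.mem_nonunits_iff_or _).2 (Or.inr htV))
      have h2 := V.add_mem _ _ (V.nonunits_le h1) (hV γ)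
      rwa [sub_add_cancel] at h2
  have hunit : ∀ V : ValuationSubring F, (∀ c : K, algebraMap K F c ∈ V) →
      ∀ b : K, algebraMap K F b ∈ V.nonunits → b = 0 := fun V hV b hb => by
    rcases (ValuationSubring.mem_nonunits_iff_or _).1 hb with h1 | h1
    · exact (map_eq_zero _).1 h1
    · exact (h1 (map_inv₀ (algebraMap K F) b ▸ hV b⁻¹)).elim
  have hc0 : c = 0 := by
    obtain ⟨V, hV, htV⟩ := exists_valuationSubring_nonunit ht
    refine hunit V hV c ?_
    have hμV : ∀ l, s⁻¹ * algebraMap K F (μ l) ∈ V.nonunits := fun l => by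
      rw [ValuationSubring.mem_nonunits_iff] at htV ⊢
      rw [map_mul]
      exact mul_lt_one_of_lt_of_le htV ((V.valuation_le_one_iff _).2 (hV _))
    have hprod : ∀ f : ι → F, (∀ i, f i ∈ V.nonunits) → ∏ i ∈ N, f i ∈ V.nonunits := fun f hf => by
      simp only [ValuationSubring.mem_nonunits_iff] at hf ⊢
      rw [map_prod]
      obtain ⟨b, hb⟩ := hN
      rw [← Finset.mul_prod_erase _ _ hb]
      exact mul_lt_one_of_lt_of_le (hf b) (Finset.prod_le_one' fun i _ => (hf i).le)
    rw [hc, hh']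
    exact sub_mem (sum_mem fun σ _ => hprod _ fun i =>
        mem_nonunits_of_minorSum_eq hq ha h0 hV hμV (hsol' σ) i)
      (sum_mem fun σ _ => hprod _ fun i => hμV (σ i))
  have hγ0 : γ = 0 := by
    obtain ⟨V, hV, hsV⟩ := exists_valuationSubring_nonunit hs
    have h1 := hmemS V hV hsV
    rw [← hc, hc0, map_zero, zero_sub, ← map_neg] at h1
    exact neg_eq_zero.1 (hunit V hV _ h1)
  rw [hγ] at hγ0
  exact sub_eq_zero.1 ((mul_eq_zero.1 hγ0).resolve_left
    (mul_ne_zero (pow_ne_zero _ (neg_ne_zero.2 one_ne_zero)) (natCast_factorial_ne_zero hchar)))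

end ValuationSubring

/-- If the zero diagonal is the only isospectral one, then `q` agrees with its average. -/
lemma apply_eq_of_forall_eq_zero {ι K : Type*} [Fintype ι] [DecidableEq ι] [Field K]
    [IsAlgClosed K] (hchar : ∀ m : ℕ, 0 < m → m ≤ Fintype.card ι → (m : K) ≠ 0)
    {q a : Finset ι → K} (hq : q ∅ = 1) (ha : a ∅ = 1) (haa : ∀ M N, #M = #N → a M = a N)
    (h0 : ∀ d : ι → K, (∀ z, minorSum 1 q d z = minorSum (1 : K) a 0 z) → d = 0)
    (N : Finset ι) : q N = a N := by
  have : Infinite K := IsAlgClosed.instInfinite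
  let μ : ι ↪ K := (Fintype.equivFin ι).toEmbedding.trans (Fin.valEmbedding.trans
    (Infinite.natEmbedding K))
  obtain ⟨s, hs, x, hx, hsol⟩ := exists_transcendental_family hq ha haa μ.injective
  induction hk : #N using Nat.strong_induction_on generalizing N with
  | _ k ih =>
    subst hk
    rcases N.eq_empty_or_nonempty with rfl | hN
    · rw [hq, ha]
    · exact apply_eq_of_family hchar hq ha haa h0 hN (fun M hM => ih _ hM M rfl) μ.injective hs
        hx hsol

section ConstantMinors

variable {ι K : Type*} [Fintype ι] [DecidableEq ι] [Field K]

lemma eval_hasseDeriv_prod (d : ι → K) (z : K) (j : ℕ) :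
    (hasseDeriv j (∏ l, (X - C (d l)))).eval z =
      ∑ M ∈ powersetCard j univ, ∏ l ∈ Mᶜ, (z - d l) := by
  have h1 : taylor z (∏ l, (X - C (d l))) = ∏ l, (X + C (z - d l)) := by
    refine (map_prod (taylorAlgHom z) _ _).trans (Finset.prod_congr rfl fun l _ => ?_)
    simp only [taylorAlgHom_apply, map_sub, taylor_X, taylor_C]
    ring
  rw [← taylor_coeff, h1, Finset.prod_add, finsetSum_coeff, powersetCard_eq_filter,
    Finset.sum_filter]
  refine Finset.sum_congr rfl fun M _ => ?_
  rw [Finset.prod_const, ← map_prod, coeff_mul_C, coeff_X_pow, ← Finset.compl_eq_univ_sdiff,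
    ite_mul, one_mul, zero_mul]
  exact if_congr eq_comm rfl rfl

lemma eq_zero_of_minorSum_eq [Infinite K] {q : Finset ι → K} (hq : q ∅ = 1)
    (hqq : ∀ M N, #M = #N → q M = q N) {d : ι → K}
    (hd : ∀ z : K, minorSum 1 q d z = minorSum 1 q 0 z) : d = 0 := by
  obtain ⟨α, hα⟩ : ∃ α : ℕ → K, ∀ M, q M = α #M := by
    refine ⟨fun j => if h : ∃ M : Finset ι, #M = j then q h.choose else 0, fun M => ?_⟩
    have h : ∃ M' : Finset ι, #M' = #M := ⟨M, rfl⟩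
    simp only [dif_pos h]
    exact (hqq _ _ h.choose_spec).symm
  set L : K[X] →ₗ[K] K[X] := ∑ j ∈ range (Fintype.card ι + 1), α j • hasseDeriv j with hL
  have hLP : ∀ (d : ι → K) (z : K), (L (∏ l, (X - C (d l)))).eval z = minorSum 1 q d z := by
    intro d z
    rw [minorSum, ← Finset.powerset_univ, Finset.sum_powerset, Finset.card_univ, hL,
      LinearMap.sum_apply, eval_finsetSum]
    refine Finset.sum_congr rfl fun j _ => ?_
    rw [LinearMap.smul_apply, eval_smul, eval_hasseDeriv_prod, smul_eq_mul, Finset.mul_sum]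
    refine Finset.sum_congr rfl fun M hM => ?_
    rw [hα, (Finset.mem_powersetCard.1 hM).2]
    simp
  have hinj : ∀ p, L p = 0 → p = 0 := by
    intro p hp
    have h1 := congrArg (coeff · p.natDegree) hp
    simp only [hL, LinearMap.sum_apply, LinearMap.smul_apply, finsetSum_coeff, coeff_smul,
      hasseDeriv_coeff, coeff_zero, smul_eq_mul] at h1
    rw [Finset.sum_eq_single 0] at h1
    · have hα0 : α 0 = 1 := by rw [← hq, hα, Finset.card_empty]
      simpa [hα0] using h1
    · intro j _ hj
      rw [coeff_eq_zero_of_natDegree_lt (by omega), mul_zero, mul_zero]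
    · simp
  have heq : ∏ l, (X - C (d l)) = ∏ l : ι, (X - C ((0 : ι → K) l)) := by
    refine sub_eq_zero.1 (hinj _ ?_)
    rw [map_sub, sub_eq_zero]
    exact Polynomial.funext fun z => by rw [hLP, hLP, hd]
  funext l
  have h1 := congrArg (eval (d l)) heq
  rw [eval_prod, eval_prod, Finset.prod_eq_zero (Finset.mem_univ l) (by simp)] at h1
  obtain ⟨b, -, hb⟩ := Finset.prod_eq_zero_iff.1 h1.symm
  simpa using hb

end ConstantMinors

section Average

variable {ι K : Type*} [Fintype ι] [DecidableEq ι] [Field K]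

/-- The average of `q` over the sets with as many elements as `M`. -/
def cardAverage (q : Finset ι → K) (M : Finset ι) : K :=
  (∑ M' ∈ powersetCard #M univ, q M') / ((Fintype.card ι).choose #M : ℕ)

lemma minorSum_cardAverage (hchar : ∀ m : ℕ, 0 < m → m ≤ Fintype.card ι → (m : K) ≠ 0)
    (q : Finset ι → K) (s z : K) : minorSum s (cardAverage q) 0 z = minorSum s q 0 z := by
  rw [minorSum_zero_right, minorSum_zero_right]
  refine Finset.sum_congr rfl fun k hk => ?_
  have hfac := natCast_factorial_ne_zero hchar
  rw [← Nat.choose_mul_factorial_mul_factorial (Nat.lt_succ_iff.1 (Finset.mem_range.1 hk)),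
    Nat.cast_mul, Nat.cast_mul] at hfac
  have hch := left_ne_zero_of_mul (left_ne_zero_of_mul hfac)
  congr 3
  have h : ∀ M ∈ powersetCard k (univ : Finset ι), cardAverage q M =
      (∑ M' ∈ powersetCard k univ, q M') / ((Fintype.card ι).choose k : ℕ) := fun M hM => by
    rw [cardAverage, (Finset.mem_powersetCard.1 hM).2]
  rw [Finset.sum_congr rfl h, Finset.sum_const, Finset.card_powersetCard, Finset.card_univ,
    nsmul_eq_mul, mul_div_cancel₀ _ hch]

end Average

section PrincipalMinors

variable {ι R : Type*} [Fintype ι] [DecidableEq ι] [CommRing R]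

lemma Matrix.det_add_diagonal (B : Matrix ι ι R) (w : ι → R) :
    (B + diagonal w).det =
      ∑ M : Finset ι, (B.submatrix ((↑) : M → ι) (↑)).det * ∏ l ∈ Mᶜ, w l := by
  have h := (detRowAlternating (R := R) (n := ι)).map_add_univ B (diagonal w)
  refine h.trans (Finset.sum_congr rfl fun M _ => ?_)
  rw [← det_piecewise_one_eq_submatrix_det]
  have hrow : (M.piecewise B (diagonal w) : ι → ι → R) = fun i =>
      (if i ∈ M then 1 else w i) • (M.piecewise B (1 : Matrix ι ι R) : ι → ι → R) i := by
    funext i j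
    by_cases hi : i ∈ M
    · simp [Finset.piecewise, hi]
    · simp [Finset.piecewise, hi, diagonal_apply, one_apply]
  rw [hrow, AlternatingMap.map_smul_univ, smul_eq_mul, mul_comm]
  congr 1
  rw [Finset.prod_ite, Finset.prod_const_one, one_mul]
  congr 1
  ext l
  simp

end PrincipalMinors

section Charpoly

variable {K : Type*} [Field K] {n : ℕ}

lemma principalMinor_neg (A : Matrix (Fin n) (Fin n) K) (N : Finset (Fin n)) :
    principalMinor (-A) N = (-1) ^ #N * principalMinor A N := by
  rw [principalMinor, Matrix.submatrix_neg, Pi.neg_apply, Pi.neg_apply, Matrix.det_neg,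
    Fintype.card_coe, principalMinor]

lemma eval_charpoly_add_diagonal (A : Matrix (Fin n) (Fin n) K) (d : Fin n → K) (z : K) :
    (A + diagonal d).charpoly.eval z = minorSum 1 (principalMinor (-A)) d z := by
  have h : scalar (Fin n) z - (A + diagonal d) = -A + diagonal fun l => z - d l := by
    rw [scalar_apply, ← diagonal_sub]
    abel
  rw [eval_charpoly, h, det_add_diagonal, minorSum]
  refine Finset.sum_congr rfl fun M _ => ?_
  rw [one_pow, mul_one]
  rfl

end Charpoly

/-- Theorem A: over an algebraically closed field of characteristic `0` or `> n`,
there exists a nonzero diagonal matrix `D` with `A` and `A + D` having the same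
characteristic polynomial (equivalently, the same spectrum) if and only if for
some `1 ≤ k ≤ n` the `k × k` principal minors of `A` are not all equal. -/
theorem exists_isospectral_diagonal_iff
    {K : Type*} [Field K] [IsAlgClosed K] {n : ℕ}
    (hchar : ∀ p : ℕ, CharP K p → p = 0 ∨ n < p)
    (A : Matrix (Fin n) (Fin n) K) :
    (∃ d : Fin n → K, d ≠ 0 ∧ (A + Matrix.diagonal d).charpoly = A.charpoly) ↔
      ∃ k, 1 ≤ k ∧ k ≤ n ∧ ∃ N M : Finset (Fin n), N.card = k ∧ M.card = k ∧
        principalMinor A N ≠ principalMinor A M := by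
  have : Infinite K := IsAlgClosed.instInfinite
  have hcast : ∀ m : ℕ, 0 < m → m ≤ Fintype.card (Fin n) → (m : K) ≠ 0 := by
    intro m hm hmn h
    rw [Fintype.card_fin] at hmn
    obtain ⟨p, hp⟩ := CharP.exists K
    have hdvd := (CharP.cast_eq_zero_iff K p m).1 h
    rcases hchar p hp with rfl | hnp
    · exact hm.ne' (zero_dvd_iff.1 hdvd)
    · exact absurd (Nat.le_of_dvd hm hdvd) (by omega)
  have hempty : principalMinor (-A) ∅ = 1 := Matrix.det_isEmpty
  have hcp : ∀ d : Fin n → K, (A + Matrix.diagonal d).charpoly = A.charpoly ↔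
      ∀ z, minorSum 1 (principalMinor (-A)) d z = minorSum 1 (principalMinor (-A)) 0 z := by
    intro d
    have h0 : A.charpoly = (A + Matrix.diagonal (0 : Fin n → K)).charpoly := by
      rw [Matrix.diagonal_zero', add_zero]
    rw [h0]
    refine ⟨fun h z => ?_, fun h => Polynomial.funext fun z => ?_⟩
    · rw [← eval_charpoly_add_diagonal, h, eval_charpoly_add_diagonal]
    · rw [eval_charpoly_add_diagonal, h, eval_charpoly_add_diagonal]
  constructor
  · rintro ⟨d, hd, hdA⟩
    by_contra hA
    refine hd (eq_zero_of_minorSum_eq hempty (fun M N hMN => ?_) ((hcp d).1 hdA))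
    rw [principalMinor_neg, principalMinor_neg, hMN]
    congr 1
    rcases M.eq_empty_or_nonempty with rfl | hM
    · rw [Finset.card_eq_zero.1 (hMN.symm.trans Finset.card_empty)]
    · by_contra hne
      exact hA ⟨#M, Finset.card_pos.2 hM, card_finset_fin_le M, M, N, rfl, hMN.symm, hne⟩
  · rintro ⟨k, -, -, N, M, hN, hM, hNM⟩
    by_contra hA
    have havg : ∀ M N : Finset (Fin n), #M = #N →
        cardAverage (principalMinor (-A)) M = cardAverage (principalMinor (-A)) N :=
      fun M N h => by rw [cardAverage, cardAverage, h]
    have hq := apply_eq_of_forall_eq_zero hcast hempty (a := cardAverage (principalMinor (-A)))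
      (by simp [cardAverage, hempty]) havg fun d hd => by
        by_contra hd0
        exact hA ⟨d, hd0, (hcp d).2 fun z => by rw [hd, minorSum_cardAverage hcast]⟩
    have h := ((hq N).trans (havg N M (hN.trans hM.symm))).trans (hq M).symm
    rw [principalMinor_neg, principalMinor_neg, hN, hM] at h
    exact hNM (mul_left_cancel₀ (pow_ne_zero _ (neg_ne_zero.2 one_ne_zero)) h)
end

section
/- Let A be the adjacency matrix of a weighted simple graph G on n vertices over ℂ. If G is neither edgeless nor complete with all edge weights equal up to sign, then there exists a nonzero diagonal matrix D such that A and A+D have the same spectrum. -/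
open Matrix

namespace MvPolynomial

section WeightFiltration

variable {σ R : Type*} [CommRing R]

/-- The polynomials all of whose monomials have weight less than `W`. -/
noncomputable def weightLT (w : σ → ℕ) (W : ℕ) : Submodule R (MvPolynomial σ R) :=
  restrictSupport R {μ | Finsupp.weight w μ < W}

variable {w : σ → ℕ} {W W' : ℕ} {p q : MvPolynomial σ R}

lemma mem_weightLT :
    p ∈ weightLT w W ↔ ∀ μ, coeff μ p ≠ 0 → Finsupp.weight w μ < W := by
  simp [weightLT, mem_restrictSupport_iff, Set.subset_def]

lemma weightLT_mono (h : W ≤ W') : weightLT (R := R) w W ≤ weightLT w W' :=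
  restrictSupport_mono _ fun _ hμ => lt_of_lt_of_le hμ h

lemma mem_weightLT_zero : p ∈ weightLT w 0 ↔ p = 0 := by
  simp [mem_weightLT, MvPolynomial.ext_iff]

lemma monomial_mem_weightLT {μ : σ →₀ ℕ} (h : Finsupp.weight w μ < W) (r : R) :
    monomial μ r ∈ weightLT w W :=
  (monomial_mem_restrictSupport R).2 (Or.inl h)

lemma C_mem_weightLT (h : 0 < W) (r : R) : C r ∈ weightLT (R := R) w W :=
  monomial_mem_weightLT (by simpa using h) r

lemma X_mem_weightLT {i : σ} (h : w i < W) : X i ∈ weightLT (R := R) w W :=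
  monomial_mem_weightLT (by simpa [Finsupp.weight_single] using h) 1

lemma mul_mem_weightLT (hp : p ∈ weightLT w (W + 1)) (hq : q ∈ weightLT w W') :
    p * q ∈ weightLT w (W + W') := by
  classical
  rw [mem_weightLT] at *
  intro μ hμ
  rw [coeff_mul] at hμ
  obtain ⟨⟨a, b⟩, hab, h⟩ := Finset.exists_ne_zero_of_sum_ne_zero hμ
  rw [Finset.HasAntidiagonal.mem_antidiagonal] at hab
  have ha := hp a (left_ne_zero_of_mul h)
  have hb := hq b (right_ne_zero_of_mul h)
  simp only at hab
  rw [← hab, map_add]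
  omega

/-- The leading term of `p` with respect to the weight `w` is the monomial `μ`. -/
def HasLeadingMonomial (w : σ → ℕ) (p : MvPolynomial σ R) (μ : σ →₀ ℕ) : Prop :=
  p - monomial μ 1 ∈ weightLT w (Finsupp.weight w μ)

lemma hasLeadingMonomial_monomial (w : σ → ℕ) (μ : σ →₀ ℕ) :
    HasLeadingMonomial w (monomial μ (1 : R)) μ := by
  simp [HasLeadingMonomial]

lemma HasLeadingMonomial.mem_weightLT {μ : σ →₀ ℕ} (h : HasLeadingMonomial w p μ) :
    p ∈ weightLT w (Finsupp.weight w μ + 1) := by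
  have := (weightLT w (Finsupp.weight w μ + 1)).add_mem
    (weightLT_mono (Nat.le_succ _) h) (monomial_mem_weightLT (Nat.lt_succ_self _) 1)
  simpa using this

lemma HasLeadingMonomial.mul {μ ν : σ →₀ ℕ} (hp : HasLeadingMonomial w p μ)
    (hq : HasLeadingMonomial w q ν) : HasLeadingMonomial w (p * q) (μ + ν) := by
  have h1 := mul_mem_weightLT hp.mem_weightLT hq
  have h2 := mul_mem_weightLT
    (hasLeadingMonomial_monomial (R := R) w ν).mem_weightLT hp
  have h3 := (weightLT w (Finsupp.weight w (μ + ν))).add_mem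
    (by rwa [map_add]) (by rwa [map_add, add_comm])
  have h4 : monomial (μ + ν) (1 : R) = monomial μ 1 * monomial ν 1 := by simp
  unfold HasLeadingMonomial
  rw [h4]
  convert h3 using 1
  ring

lemma HasLeadingMonomial.pow {μ : σ →₀ ℕ} (hp : HasLeadingMonomial w p μ) (k : ℕ) :
    HasLeadingMonomial w (p ^ k) (k • μ) := by
  induction k with
  | zero => simpa using hasLeadingMonomial_monomial (R := R) w 0
  | succ k ih => rw [pow_succ, succ_nsmul]; exact ih.mul hp

lemma HasLeadingMonomial.prod {ι : Type*} (s : Finset ι) {f : ι → MvPolynomial σ R}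
    {μ : ι → σ →₀ ℕ} (h : ∀ i ∈ s, HasLeadingMonomial w (f i) (μ i)) :
    HasLeadingMonomial w (∏ i ∈ s, f i) (∑ i ∈ s, μ i) := by
  classical
  induction s using Finset.induction_on with
  | empty => simpa using hasLeadingMonomial_monomial (R := R) w 0
  | insert a s ha ih =>
    rw [Finset.prod_insert ha, Finset.sum_insert ha]
    exact (h a (by simp)).mul (ih fun i hi => h i (by simp [hi]))

/-- The linear endomorphism sending each monomial `μ` to `u μ`. -/
noncomputable def monomialSubst (u : (σ →₀ ℕ) → MvPolynomial σ R) :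
    MvPolynomial σ R →ₗ[R] MvPolynomial σ R :=
  (basisMonomials σ R).constr R u

lemma monomialSubst_monomial (u : (σ →₀ ℕ) → MvPolynomial σ R) (μ : σ →₀ ℕ) :
    monomialSubst u (monomial μ 1) = u μ :=
  (basisMonomials σ R).constr_basis R u μ

lemma monomialSubst_sub_mem {u : (σ →₀ ℕ) → MvPolynomial σ R}
    (hu : ∀ μ, HasLeadingMonomial w (u μ) μ) (hp : p ∈ weightLT w (W + 1)) :
    monomialSubst u p - p ∈ weightLT w W := by
  have h : p ∈ Submodule.comap (monomialSubst u - LinearMap.id) (weightLT (R := R) w W) := by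
    rw [weightLT, restrictSupport_eq_span] at hp
    refine Submodule.span_le.2 ?_ hp
    rintro _ ⟨μ, hμ, rfl⟩
    simp only [SetLike.mem_coe, Submodule.mem_comap, LinearMap.sub_apply, LinearMap.id_apply,
      monomialSubst_monomial]
    exact weightLT_mono (Nat.lt_succ_iff.1 hμ) (hu μ)
  simpa using h

lemma exists_mem_weightLT (w : σ → ℕ) (p : MvPolynomial σ R) : ∃ W, p ∈ weightLT w W := by
  refine ⟨p.support.sup (Finsupp.weight w) + 1, mem_weightLT.2 fun μ hμ => ?_⟩
  exact Nat.lt_succ_of_le (Finset.le_sup (f := Finsupp.weight w) (mem_support_iff.2 hμ))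

lemma monomialSubst_bijective {u : (σ →₀ ℕ) → MvPolynomial σ R}
    (hu : ∀ μ, HasLeadingMonomial w (u μ) μ) : Function.Bijective (monomialSubst u) := by
  constructor
  · rw [injective_iff_map_eq_zero]
    intro p hp
    obtain ⟨W, hW⟩ := exists_mem_weightLT w p
    induction W with
    | zero => exact mem_weightLT_zero.1 hW
    | succ W ih =>
      have := monomialSubst_sub_mem hu hW
      rw [hp, zero_sub, Submodule.neg_mem_iff] at this
      exact ih this
  · intro p
    obtain ⟨W, hW⟩ := exists_mem_weightLT w p
    induction W generalizing p with
    | zero => exact ⟨0, by rw [mem_weightLT_zero.1 hW, map_zero]⟩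
    | succ W ih =>
      obtain ⟨q, hq⟩ := ih _ (monomialSubst_sub_mem hu hW)
      exact ⟨p - q, by rw [map_sub, hq, sub_sub_cancel]⟩

end WeightFiltration

section QuotientBasis

variable {σ R : Type*} [Fintype σ] [CommRing R]

/-- The exponent vector with entries `α k < m k`. -/
noncomputable def reducedExponent {m : σ → ℕ} (α : ∀ k, Fin (m k)) : σ →₀ ℕ :=
  Finsupp.equivFunOnFinite.symm fun k => (α k : ℕ)

@[simp] lemma reducedExponent_apply {m : σ → ℕ} (α : ∀ k, Fin (m k)) (k : σ) :
    reducedExponent α k = α k := rfl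

lemma reducedExponent_injective {m : σ → ℕ} :
    Function.Injective (reducedExponent (m := m)) := fun α β h => by
  ext k
  simpa using DFunLike.congr_fun h k

variable (g : σ → MvPolynomial σ R) (m : σ → ℕ)

/-- The product of powers of the `g k` with a reduced monomial that is associated with `μ`. -/
noncomputable def mixedMonomial (μ : σ →₀ ℕ) : MvPolynomial σ R :=
  ∏ k, (g k ^ (μ k / m k) * X k ^ (μ k % m k))

variable {g m}

lemma hasLeadingMonomial_mixedMonomial {w : σ → ℕ}
    (hg : ∀ k, HasLeadingMonomial w (g k) (Finsupp.single k (m k))) (μ : σ →₀ ℕ) :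
    HasLeadingMonomial w (mixedMonomial g m μ) μ := by
  have h := HasLeadingMonomial.prod (w := w) Finset.univ
    (f := fun k => g k ^ (μ k / m k) * X k ^ (μ k % m k))
    (μ := fun k => Finsupp.single k (μ k)) fun k _ => by
      have h1 := ((hg k).pow (μ k / m k)).mul
        ((hasLeadingMonomial_monomial (R := R) w (Finsupp.single k 1)).pow (μ k % m k))
      convert h1 using 1
      · rfl
      rw [Finsupp.smul_single, Finsupp.smul_single, ← Finsupp.single_add]
      simp [Nat.div_add_mod']
  rwa [Finsupp.univ_sum_single] at h

lemma mixedMonomial_reducedExponent (α : ∀ k, Fin (m k)) :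
    mixedMonomial g m (reducedExponent α) = monomial (reducedExponent α) 1 := by
  rw [monomial_eq, C_1, one_mul, Finsupp.prod_fintype _ _ (by simp)]
  refine Finset.prod_congr rfl fun k _ => ?_
  simp [Nat.div_eq_of_lt (α k).2, Nat.mod_eq_of_lt (α k).2]

lemma mixedMonomial_add_single (hm : ∀ k, 0 < m k) (μ : σ →₀ ℕ) (k : σ) :
    mixedMonomial g m (μ + Finsupp.single k (m k)) = g k * mixedMonomial g m μ := by
  classical
  unfold mixedMonomial
  rw [← Finset.mul_prod_erase _ _ (Finset.mem_univ k),
    ← Finset.mul_prod_erase _ _ (Finset.mem_univ k)]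
  have h : ∀ j ∈ Finset.univ.erase k, (μ + Finsupp.single k (m k)) j = μ j := fun j hj => by
    simp [Finset.ne_of_mem_erase hj]
  rw [Finset.prod_congr rfl fun j hj => by rw [h j hj]]
  simp [Nat.add_div_right _ (hm k), pow_succ]
  ring

lemma mixedMonomial_mem_span {μ : σ →₀ ℕ} (hm : ∀ k, 0 < m k) {k : σ} (h : m k ≤ μ k) :
    mixedMonomial g m μ ∈ Ideal.span (Set.range g) := by
  have : μ = (μ - Finsupp.single k (m k)) + Finsupp.single k (m k) := by
    ext j
    by_cases hj : k = j
    · subst hj; simp; omega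
    · simp [hj]
  rw [this, mixedMonomial_add_single hm]
  exact Ideal.mul_mem_right _ _ (Ideal.subset_span ⟨k, rfl⟩)

variable (m) in
/-- The coefficients of the reduced monomials. -/
noncomputable def reducedCoeff : MvPolynomial σ R →ₗ[R] ((∀ k, Fin (m k)) → R) :=
  LinearMap.pi fun α => lcoeff R (reducedExponent α)

lemma reducedCoeff_apply (p : MvPolynomial σ R) (α : ∀ k, Fin (m k)) :
    reducedCoeff m p α = coeff (reducedExponent α) p := rfl

lemma monomialSubst_mixedMonomial_mul (hm : ∀ k, 0 < m k) (k : σ) (p : MvPolynomial σ R) :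
    monomialSubst (mixedMonomial g m) (monomial (Finsupp.single k (m k)) 1 * p) =
      g k * monomialSubst (mixedMonomial g m) p := by
  induction p using MvPolynomial.induction_on' with
  | monomial μ a =>
    have h1 : monomial μ a = a • monomial μ (1 : R) := by simp [smul_monomial]
    rw [h1, mul_smul_comm, map_smul, map_smul, mul_smul_comm, monomial_mul, one_mul,
      monomialSubst_monomial, monomialSubst_monomial, add_comm, mixedMonomial_add_single hm]
  | add p q hp hq => rw [mul_add, map_add, map_add, hp, hq, mul_add]

lemma reducedCoeff_of_mem_span (hm : ∀ k, 0 < m k) {p : MvPolynomial σ R} {w : σ → ℕ}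
    (hg : ∀ k, HasLeadingMonomial w (g k) (Finsupp.single k (m k)))
    (hp : monomialSubst (mixedMonomial g m) p ∈ Ideal.span (Set.range g)) :
    reducedCoeff m p = 0 := by
  have hU := monomialSubst_bijective (hasLeadingMonomial_mixedMonomial hg)
  obtain ⟨c, hc⟩ := Ideal.mem_span_range_iff_exists_fun.1 hp
  choose f hf using fun k => hU.2 (c k)
  have : p = ∑ k, monomial (Finsupp.single k (m k)) 1 * f k := by
    apply hU.1
    rw [map_sum, ← hc]
    exact Finset.sum_congr rfl fun k _ => by
      rw [monomialSubst_mixedMonomial_mul hm, hf, mul_comm]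
  rw [this, map_sum]
  refine Finset.sum_eq_zero fun k _ => ?_
  ext α
  rw [reducedCoeff_apply, coeff_monomial_mul', if_neg, Pi.zero_apply]
  intro hle
  have := hle k
  simp at this
  have := (α k).2
  omega

/-- If `g k` has leading monomial `X k ^ m k` for all `k`, then the monomials with exponents less
than `m` form a basis of the quotient by the `g k`. -/
noncomputable def quotientBasis (hm : ∀ k, 0 < m k) {w : σ → ℕ}
    (hg : ∀ k, HasLeadingMonomial w (g k) (Finsupp.single k (m k)))
    {I : Ideal (MvPolynomial σ R)} (hI : I = Ideal.span (Set.range g)) :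
    Module.Basis (∀ k, Fin (m k)) R (MvPolynomial σ R ⧸ I) :=
  Module.Basis.mk (v := fun α => Ideal.Quotient.mkₐ R I (monomial (reducedExponent α) 1))
    (by
      classical
      rw [Fintype.linearIndependent_iff]
      intro c hc α
      have h1 : monomialSubst (mixedMonomial g m) (∑ β, c β • monomial (reducedExponent β) 1) =
          ∑ β, c β • monomial (reducedExponent β) 1 := by
        simp_rw [map_sum, map_smul, monomialSubst_monomial, mixedMonomial_reducedExponent]
      have h3 : Ideal.Quotient.mkₐ R I (∑ β, c β • monomial (reducedExponent β) 1) = 0 := by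
        rw [map_sum, ← hc]
        simp_rw [map_smul]
      replace hc := h3
      rw [Ideal.Quotient.mkₐ_eq_mk, Ideal.Quotient.eq_zero_iff_mem, hI, ← h1] at hc
      have h2 := congrFun (reducedCoeff_of_mem_span hm hg hc) α
      rw [reducedCoeff_apply, coeff_sum] at h2
      simpa [coeff_monomial, reducedExponent_injective.eq_iff] using h2)
    (by
      rintro x -
      obtain ⟨x, rfl⟩ := Ideal.Quotient.mk_surjective x
      obtain ⟨p, rfl⟩ := (monomialSubst_bijective (hasLeadingMonomial_mixedMonomial hg)).2 x
      change Ideal.Quotient.mkₐ R I _ ∈ _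
      induction p using MvPolynomial.induction_on' with
      | monomial μ a =>
        have h1 : monomial μ a = a • monomial μ (1 : R) := by simp [smul_monomial]
        rw [h1, map_smul, map_smul, monomialSubst_monomial]
        refine Submodule.smul_mem _ _ ?_
        by_cases hμ : ∀ k, μ k < m k
        · have : μ = reducedExponent fun k => ⟨μ k, hμ k⟩ := by ext; rfl
          rw [this, mixedMonomial_reducedExponent]
          exact Submodule.subset_span ⟨_, rfl⟩
        · push Not at hμ
          obtain ⟨k, hk⟩ := hμ
          have := mixedMonomial_mem_span (g := g) hm hk
          rw [← hI, ← Ideal.Quotient.eq_zero_iff_mem] at this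
          rw [Ideal.Quotient.mkₐ_eq_mk, this]
          exact Submodule.zero_mem _
      | add p q hp hq => rw [map_add, map_add]; exact Submodule.add_mem _ hp hq)

lemma quotientBasis_apply (hm : ∀ k, 0 < m k) {w : σ → ℕ}
    (hg : ∀ k, HasLeadingMonomial w (g k) (Finsupp.single k (m k)))
    {I : Ideal (MvPolynomial σ R)} (hI : I = Ideal.span (Set.range g)) (α : ∀ k, Fin (m k)) :
    quotientBasis hm hg hI α = Ideal.Quotient.mk I (monomial (reducedExponent α) 1) := by
  simp [quotientBasis]

end QuotientBasis

end MvPolynomial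

namespace Polynomial

section DividedDifference

variable {S : Type*} [CommRing S]

/-- The divided difference of `X ^ j` at the points `d 0, …, d (k - 1)`. -/
def dividedDifferencePow (d : ℕ → S) : ℕ → ℕ → S
  | 0, _ => 0
  | k + 1, 0 => if k = 0 then 1 else 0
  | k + 1, j + 1 => dividedDifferencePow d k j + d k * dividedDifferencePow d (k + 1) j

/-- The divided difference of a polynomial at the points `d 0, …, d (k - 1)`. -/
noncomputable def dividedDifference (d : ℕ → S) (k : ℕ) : S[X] →ₗ[S] S :=
  lsum fun j => LinearMap.toSpanSingleton S S (dividedDifferencePow d k j)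

variable (d : ℕ → S)

lemma dividedDifferencePow_of_lt {k j : ℕ} (h : j < k) :
    dividedDifferencePow d (k + 1) j = 0 := by
  induction j generalizing k with
  | zero => simp [dividedDifferencePow, h.ne']
  | succ j ih =>
    obtain ⟨k, rfl⟩ := Nat.exists_eq_succ_of_ne_zero (Nat.ne_zero_of_lt h)
    rw [dividedDifferencePow, ih (by omega), ih (by omega)]
    simp

lemma dividedDifferencePow_self (k : ℕ) : dividedDifferencePow d (k + 1) k = 1 := by
  induction k with
  | zero => simp [dividedDifferencePow]
  | succ k ih => rw [dividedDifferencePow, ih, dividedDifferencePow_of_lt d (by omega)]; simp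

lemma dividedDifference_apply (k : ℕ) (p : S[X]) :
    dividedDifference d k p = p.sum fun j a => a * dividedDifferencePow d k j := by
  simp [dividedDifference, lsum_apply]

lemma dividedDifference_eq_sum_range (k : ℕ) {p : S[X]} {N : ℕ} (hN : ∀ j, N ≤ j → p.coeff j = 0) :
    dividedDifference d k p =
      ∑ j ∈ Finset.range N, p.coeff j * dividedDifferencePow d k j := by
  rw [dividedDifference_apply]
  refine sum_eq_of_subset _ (by simp) fun j hj => ?_
  by_contra h
  exact mem_support_iff.1 hj (hN j (by simpa using h))

lemma dividedDifference_X_pow (k j : ℕ) :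
    dividedDifference d k (X ^ j) = dividedDifferencePow d k j := by
  rw [dividedDifference_apply, X_pow_eq_monomial, sum_monomial_index _ _ (by simp), one_mul]

lemma dividedDifference_X_mul (k : ℕ) (p : S[X]) :
    dividedDifference d (k + 1) (X * p) =
      dividedDifference d k p + d k * dividedDifference d (k + 1) p := by
  induction p using Polynomial.induction_on' with
  | add p q hp hq => simp only [mul_add, map_add, hp, hq]; ring
  | monomial j a =>
    rw [← C_mul_X_pow_eq_monomial, mul_left_comm, ← pow_succ']
    simp only [← smul_eq_C_mul, map_smul, dividedDifference_X_pow, dividedDifferencePow, smul_eq_mul]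
    ring

lemma dividedDifference_prod_mul (k : ℕ) (p : S[X]) :
    dividedDifference d k ((∏ i ∈ Finset.range k, (X - C (d i))) * p) = 0 := by
  induction k generalizing p with
  | zero => simp [dividedDifference_apply, dividedDifferencePow, sum_def]
  | succ k ih =>
    have h : (∏ i ∈ Finset.range (k + 1), (X - C (d i))) * p =
        X * ((∏ i ∈ Finset.range k, (X - C (d i))) * p) -
          d k • ((∏ i ∈ Finset.range k, (X - C (d i))) * p) := by
      rw [Finset.prod_range_succ, smul_eq_C_mul]; ring
    rw [h, map_sub, dividedDifference_X_mul, map_smul, ih, smul_eq_mul]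
    ring

lemma coeff_mem_of_dividedDifference_mem (J : Ideal S) {n : ℕ} {p : S[X]}
    (hp : ∀ j, n ≤ j → p.coeff j = 0) (h : ∀ k < n, dividedDifference d (k + 1) p ∈ J) (j : ℕ) :
    p.coeff j ∈ J := by
  rcases le_or_gt n j with hj | hj
  · simp [hp j hj]
  induction hm : n - j using Nat.strong_induction_on generalizing j with
  | _ m ih =>
  have h1 := h j hj
  rw [dividedDifference_eq_sum_range d _ hp,
    ← Finset.add_sum_erase _ _ (Finset.mem_range.2 hj), dividedDifferencePow_self, mul_one] at h1
  refine (Submodule.add_mem_iff_left _ (Submodule.sum_mem _ fun i hi => ?_)).1 h1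
  obtain ⟨hij, hin⟩ := Finset.mem_erase.1 hi
  rw [Finset.mem_range] at hin
  rcases lt_or_gt_of_ne hij with hij | hij
  · rw [dividedDifferencePow_of_lt d hij, mul_zero]; exact J.zero_mem
  · exact J.mul_mem_right _ (ih _ (by omega) i hin rfl)

lemma dividedDifference_mem (J : Ideal S) {p : S[X]} (hp : ∀ j, p.coeff j ∈ J) (k : ℕ) :
    dividedDifference d k p ∈ J := by
  rw [dividedDifference_apply]
  exact Submodule.sum_mem _ fun j _ => J.mul_mem_right _ (hp j)

end DividedDifference

end Polynomial

namespace MvPolynomial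

section DegreeFiltration

variable {σ R : Type*} [CommRing R]

/-- Polynomials over a polynomial ring of joint total degree less than `s`. -/
noncomputable def jointDegreeLT (s : ℕ) : Submodule R (Polynomial (MvPolynomial σ R)) where
  carrier := {p | ∀ j, p.coeff j ∈ weightLT (R := R) (fun _ : σ => 1) (s - j)}
  add_mem' hp hq j := by rw [Polynomial.coeff_add]; exact Submodule.add_mem _ (hp j) (hq j)
  zero_mem' j := by simp
  smul_mem' r p hp j := by rw [Polynomial.coeff_smul]; exact Submodule.smul_mem _ _ (hp j)

lemma mem_jointDegreeLT {s : ℕ} {p : Polynomial (MvPolynomial σ R)} :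
    p ∈ jointDegreeLT (R := R) s ↔
      ∀ j, p.coeff j ∈ weightLT (R := R) (fun _ : σ => 1) (s - j) := Iff.rfl

lemma jointDegreeLT_mono {s t : ℕ} (h : s ≤ t) :
    jointDegreeLT (σ := σ) (R := R) s ≤ jointDegreeLT t := fun _ hp j =>
  weightLT_mono (by omega) (hp j)

lemma coeff_eq_zero_of_mem_jointDegreeLT {s j : ℕ} {p : Polynomial (MvPolynomial σ R)}
    (hp : p ∈ jointDegreeLT (R := R) s) (h : s ≤ j) : p.coeff j = 0 := by
  have := hp j
  rwa [Nat.sub_eq_zero_of_le h, mem_weightLT_zero] at this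

lemma mul_mem_jointDegreeLT {s t : ℕ} {p q : Polynomial (MvPolynomial σ R)}
    (hp : p ∈ jointDegreeLT (R := R) (s + 1)) (hq : q ∈ jointDegreeLT (R := R) t) :
    p * q ∈ jointDegreeLT (R := R) (s + t) := by
  intro j
  rw [Polynomial.coeff_mul]
  refine Submodule.sum_mem _ fun ab hab => ?_
  rw [Finset.HasAntidiagonal.mem_antidiagonal] at hab
  rcases lt_or_ge s ab.1 with h1 | h1
  · rw [coeff_eq_zero_of_mem_jointDegreeLT hp h1, zero_mul]
    exact Submodule.zero_mem _
  rcases le_or_gt t ab.2 with h2 | h2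
  · rw [coeff_eq_zero_of_mem_jointDegreeLT hq h2, mul_zero]
    exact Submodule.zero_mem _
  · refine weightLT_mono (by omega) (mul_mem_weightLT (W := s - ab.1) ?_ (hq ab.2))
    exact weightLT_mono (by omega) (hp ab.1)

lemma X_mem_jointDegreeLT : (Polynomial.X : Polynomial (MvPolynomial σ R)) ∈
    jointDegreeLT (R := R) 2 := by
  intro j
  rw [Polynomial.coeff_X]
  split_ifs with h
  · subst h; exact C_mem_weightLT (by norm_num) 1
  · exact Submodule.zero_mem _

lemma C_mem_jointDegreeLT {s : ℕ} {p : MvPolynomial σ R}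
    (hp : p ∈ weightLT (R := R) (fun _ : σ => 1) s) :
    Polynomial.C p ∈ jointDegreeLT (R := R) s := by
  intro j
  rw [Polynomial.coeff_C]
  split_ifs with h
  · subst h; exact hp
  · exact Submodule.zero_mem _

lemma prod_mem_jointDegreeLT {ι : Type*} (t : Finset ι) {f : ι → Polynomial (MvPolynomial σ R)}
    {s : ι → ℕ} (h : ∀ i ∈ t, f i ∈ jointDegreeLT (R := R) (s i + 1)) :
    ∏ i ∈ t, f i ∈ jointDegreeLT (R := R) (∑ i ∈ t, s i + 1) := by
  classical
  induction t using Finset.induction_on with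
  | empty => simpa using C_mem_jointDegreeLT (C_mem_weightLT (σ := σ) one_pos (1 : R))
  | insert a t ha ih =>
    rw [Finset.prod_insert ha, Finset.sum_insert ha, add_assoc]
    exact mul_mem_jointDegreeLT (h a (by simp)) (ih fun i hi => h i (by simp [hi]))

lemma prod_add_sub_prod_mem_jointDegreeLT {ι : Type*} (t : Finset ι)
    {a b : ι → Polynomial (MvPolynomial σ R)} (ha : ∀ i ∈ t, a i ∈ jointDegreeLT (R := R) 2)
    (hb : ∀ i ∈ t, b i ∈ jointDegreeLT (R := R) 1) :
    ∏ i ∈ t, (a i + b i) - ∏ i ∈ t, a i ∈ jointDegreeLT (R := R) t.card := by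
  classical
  induction t using Finset.induction_on with
  | empty => simp
  | insert i t hi ih =>
    have ha' : ∏ i ∈ t, a i ∈ jointDegreeLT (R := R) (t.card + 1) := by
      simpa using prod_mem_jointDegreeLT t (s := fun _ => 1) fun i hi => ha i (by simp [hi])
    have h1 := mul_mem_jointDegreeLT (s := 1) (Submodule.add_mem _ (ha i (by simp))
      (jointDegreeLT_mono (by norm_num) (hb i (by simp))))
      (ih (fun i hi => ha i (by simp [hi])) fun i hi => hb i (by simp [hi]))
    have h2 := mul_mem_jointDegreeLT (s := 0) (hb i (by simp)) ha'
    rw [Finset.prod_insert hi, Finset.prod_insert hi, Finset.card_insert_of_notMem hi]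
    convert Submodule.add_mem _ (jointDegreeLT_mono (by omega) h1)
      (jointDegreeLT_mono (t := t.card + 1) (by omega) h2) using 1
    ring

lemma map_sub_X_pow_mem_jointDegreeLT {q : Polynomial R} (hq : q.Monic) :
    q.map C - Polynomial.X ^ q.natDegree ∈ jointDegreeLT (σ := σ) (R := R) q.natDegree := by
  intro j
  rw [Polynomial.coeff_sub, Polynomial.coeff_map, Polynomial.coeff_X_pow]
  rcases lt_trichotomy j q.natDegree with h | h | h
  · rw [if_neg h.ne, sub_zero]; exact C_mem_weightLT (by omega) _
  · rw [if_pos h, h, hq.coeff_natDegree]; simp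
  · rw [if_neg h.ne', Polynomial.coeff_eq_zero_of_natDegree_lt h]; simp

variable [Fintype σ] [DecidableEq σ]

/-- The matrix `M + diag (X i)` with generic diagonal perturbation. -/
noncomputable def genericDiagonalPerturbation (M : Matrix σ σ R) :
    Matrix σ σ (MvPolynomial σ R) :=
  M.map C + diagonal X

lemma charpoly_genericDiagonalPerturbation_sub_mem (M : Matrix σ σ R) :
    (genericDiagonalPerturbation M).charpoly -
      ∏ i, (Polynomial.X - Polynomial.C (X i)) ∈ jointDegreeLT (R := R) (Fintype.card σ) := by
  set A := (genericDiagonalPerturbation M).charmatrix with hA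
  have hdiag : ∀ i, A i i = (Polynomial.X - Polynomial.C (X i)) + (- Polynomial.C (C (M i i))) := by
    intro i
    simp [hA, charmatrix_apply_eq, genericDiagonalPerturbation]
    ring
  have hoff : ∀ i j, i ≠ j → A i j = - Polynomial.C (C (M i j)) := by
    intro i j h
    simp [hA, genericDiagonalPerturbation, h]
  have hC : ∀ i j, - Polynomial.C (C (M i j)) ∈ jointDegreeLT (σ := σ) (R := R) 1 := fun i j =>
    Submodule.neg_mem _ (C_mem_jointDegreeLT (C_mem_weightLT one_pos _))
  have hX : ∀ i : σ, Polynomial.X - Polynomial.C (X i) ∈ jointDegreeLT (R := R) 2 := fun i =>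
    Submodule.sub_mem _ X_mem_jointDegreeLT (C_mem_jointDegreeLT (X_mem_weightLT one_lt_two))
  rw [Matrix.charpoly, det_apply, ← Finset.add_sum_erase _ _ (Finset.mem_univ 1), add_sub_right_comm]
  refine Submodule.add_mem _ ?_ (Submodule.sum_mem _ fun π hπ => ?_)
  · simp only [Equiv.Perm.sign_one, one_smul, Equiv.Perm.one_apply]
    rw [← hA]
    simp_rw [hdiag]
    exact prod_add_sub_prod_mem_jointDegreeLT _ (fun i _ => hX i) fun i _ => hC i i
  · have h1 : ∏ i, A (π i) i ∈ jointDegreeLT (R := R) (∑ i, (if π i = i then 1 else 0) + 1) := by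
      refine prod_mem_jointDegreeLT _ fun i _ => ?_
      split_ifs with h
      · rw [h, hdiag]
        exact Submodule.add_mem _ (hX i) (jointDegreeLT_mono (by norm_num) (hC i i))
      · rw [hoff _ _ h]; exact hC _ _
    have h2 : ∑ i, (if π i = i then 1 else 0) + 1 ≤ Fintype.card σ := by
      rw [← Finset.card_filter, Nat.succ_le_iff, Finset.card_lt_iff_ne_univ, Ne,
        Finset.filter_eq_self]
      intro h
      exact Finset.ne_of_mem_erase hπ (Equiv.ext fun i => h i (Finset.mem_univ i))
    have h3 := jointDegreeLT_mono h2 h1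
    rcases Int.units_eq_one_or (Equiv.Perm.sign π) with h | h <;> rw [h]
    · simpa using h3
    · simpa using h3

end DegreeFiltration
end MvPolynomial

namespace MvPolynomial

section IsospectralAlgebra

variable {n : ℕ} {R S : Type*} [CommRing R] [CommRing S]

/-- The ideal of the conditions on `d` for `M + diag d` to have characteristic polynomial `q`. -/
noncomputable def isospectralIdeal (M : Matrix (Fin n) (Fin n) R) (q : Polynomial R) :
    Ideal (MvPolynomial (Fin n) R) :=
  Ideal.span (Set.range fun j =>
    ((genericDiagonalPerturbation M).charpoly - q.map C).coeff j)

lemma isospectralIdeal_le_ker_iff {M : Matrix (Fin n) (Fin n) R} {q : Polynomial R}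
    (f : MvPolynomial (Fin n) R →+* S) :
    isospectralIdeal M q ≤ RingHom.ker f ↔
      (M.map (f.comp C) + diagonal fun i => f (X i)).charpoly = q.map (f.comp C) := by
  have h1 : (M.map (f.comp C) + diagonal fun i => f (X i)) =
      f.mapMatrix (genericDiagonalPerturbation M) := by
    rw [genericDiagonalPerturbation, map_add]
    congr 1
    simp [diagonal_map]
  rw [h1, RingHom.mapMatrix_apply, Matrix.charpoly_map, ← Polynomial.map_map, isospectralIdeal,
    Ideal.span_le, Set.range_subset_iff, ← sub_eq_zero, ← Polynomial.map_sub, Polynomial.ext_iff]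
  simp [RingHom.mem_ker]

/-- The indeterminates of `MvPolynomial (Fin n) R`, extended by zero to all indices. -/
noncomputable def extendedX (n : ℕ) (R : Type*) [CommRing R] (i : ℕ) : MvPolynomial (Fin n) R :=
  if h : i < n then X ⟨i, h⟩ else 0

/-- A weight for which `X k` strictly increases with `k` but a product of indeterminates is mostly
compared by its degree. -/
def indexWeight (n : ℕ) (k : Fin n) : ℕ := n * n + k

lemma hasLeadingMonomial_dividedDifferencePow {k : ℕ} (hk : k < n) (m : ℕ) :
    HasLeadingMonomial (indexWeight n)
      (Polynomial.dividedDifferencePow (extendedX n R) (k + 1) (k + m))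
      (Finsupp.single ⟨k, hk⟩ m) := by
  induction k generalizing m with
  | zero =>
    induction m with
    | zero =>
      rw [Polynomial.dividedDifferencePow_self]
      simpa using hasLeadingMonomial_monomial (R := R) (indexWeight n) 0
    | succ m ih =>
      rw [← add_assoc, Polynomial.dividedDifferencePow, add_comm m 1, Finsupp.single_add]
      simp only [Polynomial.dividedDifferencePow, zero_add, extendedX, hk, dif_pos]
      refine (hasLeadingMonomial_monomial (R := R) _ _).mul ?_
      simpa using ih
  | succ k ihk =>
    induction m with
    | zero =>
      rw [add_zero, Polynomial.dividedDifferencePow_self]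
      simpa using hasLeadingMonomial_monomial (R := R) (indexWeight n) 0
    | succ m ih =>
      have h1 := (ihk (by omega) (m + 1)).mem_weightLT
      have h2 := (hasLeadingMonomial_monomial (R := R) (indexWeight n)
        (Finsupp.single (⟨k + 1, hk⟩ : Fin n) 1)).mul ih
      rw [← Finsupp.single_add, add_comm 1 m] at h2
      rw [← add_assoc (k + 1), Polynomial.dividedDifferencePow, HasLeadingMonomial, add_sub_assoc]
      refine Submodule.add_mem _ (weightLT_mono ?_ (by rwa [show k + 1 + m = k + (m + 1) by ring])) ?_
      · simp only [Finsupp.weight_single, indexWeight, smul_eq_mul]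
        nlinarith
      · simp only [extendedX, hk, dif_pos]; exact h2

lemma weight_le_mul {σ : Type*} {w : σ → ℕ} {B : ℕ} (hw : ∀ i, w i ≤ B) (μ : σ →₀ ℕ) :
    Finsupp.weight w μ ≤ B * Finsupp.weight (fun _ => 1) μ := by
  simp only [Finsupp.weight_apply, Finsupp.sum, Finset.mul_sum, smul_eq_mul, mul_one]
  exact Finset.sum_le_sum fun i _ => by rw [mul_comm B]; exact Nat.mul_le_mul_left _ (hw i)

lemma dividedDifference_mem_weightLT {p : Polynomial (MvPolynomial (Fin n) R)}
    (hp : p ∈ jointDegreeLT (R := R) n) (k : Fin n) :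
    Polynomial.dividedDifference (extendedX n R) (k + 1) p ∈
      weightLT (R := R) (indexWeight n) ((n - k) * indexWeight n k) := by
  rw [Polynomial.dividedDifference_eq_sum_range _ _
    fun j hj => coeff_eq_zero_of_mem_jointDegreeLT hp hj]
  refine Submodule.sum_mem _ fun j hj => ?_
  rw [Finset.mem_range] at hj
  rcases lt_or_ge j k with h | h
  · rw [Polynomial.dividedDifferencePow_of_lt _ h, mul_zero]; exact Submodule.zero_mem _
  obtain ⟨m, rfl⟩ := Nat.exists_eq_add_of_le h
  have h1 := (hasLeadingMonomial_dividedDifferencePow (R := R) k.2 m).mem_weightLT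
  have h2 : p.coeff (k + m) ∈ weightLT (R := R) (indexWeight n) ((n - (k + m)) * (n * n)) := by
    rw [mem_weightLT]
    intro μ hμ
    have h3 := mem_weightLT.1 (hp (k + m)) μ hμ
    have h4 : ∀ i, indexWeight n i ≤ n * n + (n - 1) := fun i => by
      have := i.2; simp only [indexWeight]; omega
    refine (weight_le_mul h4 μ).trans_lt ?_
    generalize Finsupp.weight (fun _ => 1) μ = D at h3
    obtain ⟨e, he⟩ := Nat.exists_eq_add_of_lt h3
    obtain ⟨n, rfl⟩ : ∃ l, n = l + 1 := ⟨n - 1, by omega⟩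
    have h5 : D ≤ n := by omega
    rw [he]
    simp only [Nat.add_sub_cancel]
    nlinarith [Nat.mul_le_mul_right n h5, Nat.zero_le (e * ((n+1) * (n+1)))]
  rw [mul_comm (p.coeff _)]
  refine weightLT_mono ?_ (mul_mem_weightLT h1 h2)
  simp only [Finsupp.weight_single, smul_eq_mul, Fin.eta]
  obtain ⟨l, hl⟩ := Nat.exists_eq_add_of_le hj.le
  have h6 : n - (k + m) = l := by omega
  have h7 : n - k = m + l := by omega
  rw [h6, h7, add_mul]
  exact Nat.add_le_add_left (Nat.mul_le_mul_left _ (Nat.le_add_right _ _)) _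

variable (M : Matrix (Fin n) (Fin n) R) (q : Polynomial R)

/-- Generators of the isospectral ideal with leading monomials `X k ^ (n - k)`. -/
noncomputable def isospectralGenerator (k : Fin n) : MvPolynomial (Fin n) R :=
  Polynomial.dividedDifference (extendedX n R) (k + 1)
    (q.map C - (genericDiagonalPerturbation M).charpoly)

variable {M q}

lemma charpoly_sub_prod_mem :
    (genericDiagonalPerturbation M).charpoly -
      ∏ i, (Polynomial.X - Polynomial.C (X i)) ∈ jointDegreeLT (R := R) n := by
  simpa using charpoly_genericDiagonalPerturbation_sub_mem M

lemma dividedDifference_prod_X_sub_X (k : Fin n) :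
    Polynomial.dividedDifference (extendedX n R) (k + 1)
      (∏ i : Fin n, (Polynomial.X - Polynomial.C (X i))) = 0 := by
  have h : (∏ i : Fin n, (Polynomial.X - Polynomial.C (X i : MvPolynomial (Fin n) R))) =
      ∏ i ∈ Finset.range n, (Polynomial.X - Polynomial.C (extendedX n R i)) := by
    rw [← Fin.prod_univ_eq_prod_range]
    simp [extendedX]
  rw [h, ← Finset.prod_range_mul_prod_Ico _ k.2]
  exact Polynomial.dividedDifference_prod_mul _ _ _

lemma hasLeadingMonomial_isospectralGenerator (hq : q.Monic) (hd : q.natDegree = n) (k : Fin n) :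
    HasLeadingMonomial (indexWeight n) (isospectralGenerator M q k)
      (Finsupp.single k (n - k)) := by
  have h1 := hasLeadingMonomial_dividedDifferencePow (R := R) k.2 (n - k)
  rw [Nat.add_sub_cancel' k.2.le] at h1
  have h2 := map_sub_X_pow_mem_jointDegreeLT (σ := Fin n) hq
  rw [hd] at h2
  have h3 := dividedDifference_mem_weightLT
    (Submodule.sub_mem _ h2 (charpoly_sub_prod_mem (M := M))) k
  rw [map_sub, map_sub, map_sub, dividedDifference_prod_X_sub_X, sub_zero,
    Polynomial.dividedDifference_X_pow] at h3
  rw [HasLeadingMonomial] at h1 ⊢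
  rw [show (n - k) * indexWeight n k =
    Finsupp.weight (indexWeight n) (Finsupp.single k (n - k : ℕ)) by
      rw [Finsupp.weight_single]; rfl] at h3
  convert Submodule.add_mem _ h1 h3 using 1
  rw [isospectralGenerator, map_sub]
  ring

lemma isospectralIdeal_eq_span (hq : q.Monic) (hd : q.natDegree = n) :
    isospectralIdeal M q = Ideal.span (Set.range (isospectralGenerator M q)) := by
  apply le_antisymm
  · rw [isospectralIdeal, Ideal.span_le, Set.range_subset_iff]
    intro j
    rw [SetLike.mem_coe, ← neg_mem_iff, ← Polynomial.coeff_neg, neg_sub]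
    refine Polynomial.coeff_mem_of_dividedDifference_mem (extendedX n R) _ (n := n) ?_
      (fun k hk => Ideal.subset_span (Set.mem_range_self (⟨k, hk⟩ : Fin n))) j
    intro j hj
    rcases subsingleton_or_nontrivial R with hR | hR
    · exact Subsingleton.elim _ _
    rw [Polynomial.coeff_sub, sub_eq_zero]
    have hF := Matrix.charpoly_monic (genericDiagonalPerturbation M)
    have hFd := Matrix.charpoly_natDegree_eq_dim (genericDiagonalPerturbation M)
    have hqd : (q.map (C (σ := Fin n))).natDegree = n := by rw [hq.natDegree_map, hd]
    rw [Fintype.card_fin] at hFd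
    rcases hj.eq_or_lt with rfl | hj
    · have h1 := (hq.map (C (σ := Fin n))).coeff_natDegree
      have h2 := hF.coeff_natDegree
      rw [hqd] at h1
      rw [hFd] at h2
      rw [h1, h2]
    · rw [Polynomial.coeff_eq_zero_of_natDegree_lt (by omega),
        Polynomial.coeff_eq_zero_of_natDegree_lt (by omega)]
  · rw [Ideal.span_le, Set.range_subset_iff]
    intro k
    refine Polynomial.dividedDifference_mem _ _ (fun j => ?_) _
    rw [← neg_mem_iff, ← Polynomial.coeff_neg, neg_sub]
    exact Ideal.subset_span ⟨j, rfl⟩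

variable (M q) in
/-- The algebra of diagonal perturbations of `M` with characteristic polynomial `q`. -/
abbrev IsospectralAlgebra : Type _ := MvPolynomial (Fin n) R ⧸ isospectralIdeal M q

/-- The monomial basis of the algebra of isospectral diagonal perturbations. -/
noncomputable def isospectralBasis (M : Matrix (Fin n) (Fin n) R) (hq : q.Monic)
    (hd : q.natDegree = n) :
    Module.Basis (∀ k : Fin n, Fin (n - k)) R (IsospectralAlgebra M q) :=
  quotientBasis (fun k => Nat.sub_pos_of_lt k.2) (hasLeadingMonomial_isospectralGenerator hq hd)
    (isospectralIdeal_eq_span hq hd)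

lemma isospectralBasis_apply (hq : q.Monic) (hd : q.natDegree = n)
    (α : ∀ k : Fin n, Fin (n - k)) :
    isospectralBasis M hq hd α = Ideal.Quotient.mk _ (monomial (reducedExponent α) 1) :=
  quotientBasis_apply _ _ _ _

lemma card_reducedExponents : Fintype.card (∀ k : Fin n, Fin (n - k)) = n.factorial := by
  rw [Fintype.card_pi]
  simp only [Fintype.card_fin]
  rw [Fin.prod_univ_eq_prod_range (fun k => n - k), ← Finset.prod_range_add_one_eq_factorial,
    ← Finset.prod_range_reflect]
  exact Finset.prod_congr rfl fun k hk => by rw [Finset.mem_range] at hk; omega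

end IsospectralAlgebra
end MvPolynomial

lemma Algebra.trace_map_of_basis {ι R R' B B' : Type*} [Fintype ι] [CommRing R] [CommRing R']
    [CommRing B] [CommRing B'] [Algebra R B] [Algebra R' B'] (b : Module.Basis ι R B)
    (b' : Module.Basis ι R' B') (φ : R →+* R') (ψ : B →+* B')
    (hψ : ∀ r x, ψ (r • x) = φ r • ψ x) (hb : ∀ i, ψ (b i) = b' i) (x : B) :
    Algebra.trace R' B' (ψ x) = φ (Algebra.trace R B x) := by
  classical
  have h : ∀ y i, b'.repr (ψ y) i = φ (b.repr y i) := fun y i => by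
    conv_lhs => rw [← b.sum_repr y, map_sum]
    simp only [hψ, hb]
    rw [b'.repr_sum_self]
  rw [Algebra.trace_eq_matrix_trace b, Algebra.trace_eq_matrix_trace b', Matrix.trace, Matrix.trace,
    map_sum]
  refine Finset.sum_congr rfl fun i _ => ?_
  rw [Matrix.diag, Matrix.diag, Algebra.leftMulMatrix_eq_repr_mul,
    Algebra.leftMulMatrix_eq_repr_mul, ← hb, ← map_mul, h]

lemma Matrix.charpoly_smul_eq_charpoly_smul {σ R : Type*} [Fintype σ] [DecidableEq σ] [CommRing R]
    {c c' : R} (hc : c * c' = 1) {M N : Matrix σ σ R} (h : M.charpoly = N.charpoly) :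
    (c • M).charpoly = (c • N).charpoly := by
  have key : ∀ M : Matrix σ σ R, (c • M).charpoly = Polynomial.C c ^ Fintype.card σ *
      M.charpoly.comp (Polynomial.C c' * Polynomial.X) := fun M => by
    have h1 : (c • M).charmatrix = Polynomial.C c •
        (Polynomial.compRingHom (Polynomial.C c' * Polynomial.X)).mapMatrix M.charmatrix := by
      ext1 i j
      have h2 : Polynomial.C c * (Polynomial.C c' * Polynomial.X) = Polynomial.X := by
        rw [← mul_assoc, ← Polynomial.C_mul, hc, Polynomial.C_1, one_mul]
      rcases eq_or_ne i j with rfl | hij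
      · simp [charmatrix_apply_eq, mul_sub, h2]
      · simp [charmatrix_apply_ne _ _ _ hij]
    rw [charpoly, h1, det_smul, ← RingHom.map_det]
    rfl
  rw [key, key, h]

namespace MvPolynomial

section PairTrace

variable {n : ℕ} {R R' S : Type*} [CommRing R] [CommRing R'] [CommRing S]

lemma charpoly_isospectralAlgebra (M : Matrix (Fin n) (Fin n) R) (q : Polynomial R) :
    (M.map (algebraMap R (IsospectralAlgebra M q)) +
      diagonal fun i => Ideal.Quotient.mk (isospectralIdeal M q) (X i)).charpoly =
        q.map (algebraMap R (IsospectralAlgebra M q)) :=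
  (isospectralIdeal_le_ker_iff (Ideal.Quotient.mk _)).1 (by rw [Ideal.mk_ker])

/-- The algebra homomorphism given by a diagonal perturbation with characteristic polynomial `q`. -/
noncomputable def isospectralLift {M : Matrix (Fin n) (Fin n) R} {q : Polynomial R} [Algebra R S]
    (d : Fin n → S)
    (h : (M.map (algebraMap R S) + diagonal d).charpoly = q.map (algebraMap R S)) :
    IsospectralAlgebra M q →ₐ[R] S :=
  Ideal.Quotient.liftₐ _ (aeval d) fun a ha => by
    refine (isospectralIdeal_le_ker_iff (aeval d : _ →ₐ[R] S).toRingHom).2 ?_ ha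
    have h1 : (aeval d : _ →ₐ[R] S).toRingHom.comp C = algebraMap R S := by
      ext; simp
    rw [h1]
    simpa using h

lemma isospectralLift_mk {M : Matrix (Fin n) (Fin n) R} {q : Polynomial R} [Algebra R S]
    (d : Fin n → S)
    (h : (M.map (algebraMap R S) + diagonal d).charpoly = q.map (algebraMap R S))
    (p : MvPolynomial (Fin n) R) :
    isospectralLift d h (Ideal.Quotient.mk _ p) = aeval d p := rfl

/-- The sum of `d i * d j` over the diagonal perturbations `d` of `M` with characteristic
polynomial `q`, counted with multiplicity. -/
noncomputable def pairTrace (M : Matrix (Fin n) (Fin n) R) (q : Polynomial R) (i j : Fin n) : R :=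
  Algebra.trace R (IsospectralAlgebra M q) (Ideal.Quotient.mk _ (X i * X j))

lemma pairTrace_map (φ : R →+* R') (M : Matrix (Fin n) (Fin n) R) {q : Polynomial R}
    (hq : q.Monic) (hd : q.natDegree = n) (i j : Fin n) :
    pairTrace (M.map φ) (q.map φ) i j = φ (pairTrace M q i j) := by
  rcases subsingleton_or_nontrivial R' with hR | hR
  · exact Subsingleton.elim _ _
  let f : MvPolynomial (Fin n) R →+* IsospectralAlgebra (M.map φ) (q.map φ) :=
    (Ideal.Quotient.mk _).comp (MvPolynomial.map φ)
  have hf : ∀ a ∈ isospectralIdeal M q, f a = 0 := by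
    change isospectralIdeal M q ≤ RingHom.ker f
    rw [isospectralIdeal_le_ker_iff]
    have h1 : f.comp C = (algebraMap R' (IsospectralAlgebra (M.map φ) (q.map φ))).comp φ := by
      ext r
      simp only [f, RingHom.comp_apply, map_C]
      rfl
    have h2 := charpoly_isospectralAlgebra (M.map φ) (q.map φ)
    rw [Polynomial.map_map, Matrix.map_map] at h2
    simp only [h1, f, RingHom.comp_apply, map_X]
    exact h2
  have key := Algebra.trace_map_of_basis (isospectralBasis M hq hd)
    (isospectralBasis (M.map φ) (hq.map φ) (by rw [hq.natDegree_map, hd])) φ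
    (Ideal.Quotient.lift _ f hf) (fun r x => by
      obtain ⟨p, rfl⟩ := Ideal.Quotient.mk_surjective x
      rw [Algebra.smul_def, Algebra.smul_def, map_mul]
      congr 1
      change f (C r) = _
      simp only [f, RingHom.comp_apply, map_C]
      rfl) (fun α => by
      rw [isospectralBasis_apply, isospectralBasis_apply, Ideal.Quotient.lift_mk]
      simp only [f, RingHom.comp_apply, map_monomial, map_one])
    (Ideal.Quotient.mk _ (X i * X j))
  rw [pairTrace, pairTrace, ← key, Ideal.Quotient.lift_mk]
  simp [f]

lemma charpoly_smul_map_add_diagonal [Algebra R S] {a a' : R} (ha : a * a' = 1)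
    {M N : Matrix (Fin n) (Fin n) R} {d : Fin n → S}
    (h : (M.map (algebraMap R S) + diagonal d).charpoly = N.charpoly.map (algebraMap R S)) :
    ((a • M).map (algebraMap R S) + diagonal (a • d)).charpoly =
      (a • N).charpoly.map (algebraMap R S) := by
  rw [← Matrix.charpoly_map] at h ⊢
  have h1 := charpoly_smul_eq_charpoly_smul (c := algebraMap R S a) (c' := algebraMap R S a')
    (by rw [← map_mul, ha, map_one]) h
  convert h1 using 2
  · ext k l
    rcases eq_or_ne k l with rfl | hkl
    · simp [mul_add, Algebra.smul_def a (d k)]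
    · simp [hkl]
  · ext k l
    simp

lemma pairTrace_smul {c c' : R} (hc : c * c' = 1) (M N : Matrix (Fin n) (Fin n) R)
    (i j : Fin n) :
    pairTrace (c • M) (c • N).charpoly i j = c ^ 2 * pairTrace M N.charpoly i j := by
  let f := isospectralLift _ (charpoly_smul_map_add_diagonal hc (charpoly_isospectralAlgebra M N.charpoly))
  have hc' : c' * c = 1 := by rw [mul_comm, hc]
  have h2 := charpoly_smul_map_add_diagonal hc' (charpoly_isospectralAlgebra (c • M) (c • N).charpoly)
  rw [smul_smul, smul_smul, hc', one_smul, one_smul] at h2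
  let g := isospectralLift _ h2
  let e : IsospectralAlgebra (c • M) (c • N).charpoly ≃ₐ[R] IsospectralAlgebra M N.charpoly :=
    AlgEquiv.ofAlgHom f g (by
      refine Ideal.Quotient.algHom_ext _ (MvPolynomial.algHom_ext fun k => ?_)
      change f (g (Ideal.Quotient.mk _ (X k))) = _
      simp only [f, g, isospectralLift_mk, aeval_X, Pi.smul_apply, map_smul, smul_smul, hc']
      simp) (by
      refine Ideal.Quotient.algHom_ext _ (MvPolynomial.algHom_ext fun k => ?_)
      change g (f (Ideal.Quotient.mk _ (X k))) = _
      simp only [f, g, isospectralLift_mk, aeval_X, Pi.smul_apply, map_smul, smul_smul, hc]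
      simp)
  rw [pairTrace, ← Algebra.trace_eq_of_algEquiv e]
  have h3 : e (Ideal.Quotient.mk _ (X i * X j)) =
      c ^ 2 • Ideal.Quotient.mk (isospectralIdeal M N.charpoly) (X i * X j) := by
    change f (Ideal.Quotient.mk _ (X i * X j)) = _
    simp only [f, isospectralLift_mk, map_mul, aeval_X, Pi.smul_apply, smul_mul_smul_comm, sq]
  rw [h3, map_smul, smul_eq_mul, pairTrace]

end PairTrace
end MvPolynomial

namespace MvPolynomial

section Solutions

variable {n : ℕ} {R : Type*} [CommRing R]

lemma pairTrace_eq_zero {K : Type*} [Field K] [IsAlgClosed K] {A : Matrix (Fin n) (Fin n) K}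
    (hA : ∀ d : Fin n → K, (A + diagonal d).charpoly = A.charpoly → d = 0) (i j : Fin n) :
    pairTrace A A.charpoly i j = 0 := by
  have h1 : X i * X j ∈ (isospectralIdeal A A.charpoly).radical := by
    rw [← vanishingIdeal_zeroLocus_eq_radical (K := K), mem_vanishingIdeal_iff]
    intro d hd
    have h2 := (isospectralIdeal_le_ker_iff (aeval d : _ →ₐ[K] K).toRingHom).1
      fun p hp => hd p hp
    have h3 : (aeval d : MvPolynomial (Fin n) K →ₐ[K] K).toRingHom.comp C = RingHom.id K := by
      ext; simp
    rw [h3] at h2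
    have h4 := hA d (by simpa using h2)
    simp [h4]
  obtain ⟨m, hm⟩ := h1
  rw [pairTrace]
  refine (Algebra.isNilpotent_trace_of_isNilpotent ⟨m, ?_⟩).eq_zero
  rw [← map_pow, Ideal.Quotient.eq_zero_iff_mem.2 hm]

lemma pairTrace_eq_sum {ι : Type*} [Fintype ι] (hι : Fintype.card ι = n.factorial)
    {M : Matrix (Fin n) (Fin n) R} {q : Polynomial R} (hq : q.Monic) (hd : q.natDegree = n)
    (e : ι → Fin n → R) (he : ∀ a, (M + diagonal (e a)).charpoly = q)
    (hsep : ∀ a b, a ≠ b → ∃ i, IsUnit (e a i - e b i)) (i j : Fin n) :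
    pairTrace M q i j = ∑ a, e a i * e a j := by
  classical
  let F : IsospectralAlgebra M q →ₐ[R] (ι → R) :=
    AlgHom.pi fun a => isospectralLift (e a) (by simpa using he a)
  have hF : ∀ p a, F (Ideal.Quotient.mk _ p) a = aeval (e a) p := fun p a => rfl
  have hv : ∀ a b, ∃ x, F x a = 1 ∧ (a ≠ b → F x b = 0) := by
    intro a b
    by_cases hab : a = b
    · exact ⟨1, by simp, fun h => absurd hab h⟩
    obtain ⟨k, u, hu⟩ := hsep a b hab
    refine ⟨Ideal.Quotient.mk _ (C (↑u⁻¹ : R) * (X k - C (e b k))), ?_, fun _ => ?_⟩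
    · rw [hF]; simp [← hu]
    · rw [hF]; simp
  choose v hv1 hv0 using hv
  have hu : ∀ a, F (∏ b, v a b) = Pi.single a 1 := by
    intro a
    ext c
    rw [map_prod, Finset.prod_apply]
    rcases eq_or_ne c a with rfl | hc
    · rw [Pi.single_eq_same]; exact Finset.prod_eq_one fun b _ => hv1 c b
    · rw [Pi.single_eq_of_ne hc]
      exact Finset.prod_eq_zero (Finset.mem_univ c) (hv0 a c hc.symm)
  have hsurj : Function.Surjective F := fun f =>
    ⟨∑ a, f a • ∏ b, v a b, by
      simp only [map_sum, map_smul, hu]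
      ext c
      simp [Pi.single_apply]⟩
  let E := (Pi.basisFun R ι).equiv (isospectralBasis M hq hd)
    (Fintype.equivOfCardEq (by rw [hι, card_reducedExponents]))
  have hinj : Function.Injective F := by
    have h := OrzechProperty.injective_of_surjective_endomorphism
      (F.toLinearMap ∘ₗ E.toLinearMap) (hsurj.comp E.surjective)
    intro x y hxy
    obtain ⟨x, rfl⟩ := E.surjective x
    obtain ⟨y, rfl⟩ := E.surjective y
    rw [h hxy]
  rw [pairTrace, ← Algebra.trace_eq_of_algEquiv (AlgEquiv.ofBijective F ⟨hinj, hsurj⟩),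
    Algebra.trace_eq_matrix_trace (Pi.basisFun R ι), Matrix.trace]
  refine Finset.sum_congr rfl fun a _ => ?_
  rw [Matrix.diag, Algebra.leftMulMatrix_eq_repr_mul]
  simp only [Pi.basisFun_apply, Pi.basisFun_repr, Pi.mul_apply, Pi.single_eq_same, mul_one]
  exact (hF _ a).trans (by simp)

end Solutions

end MvPolynomial

section Perturbation

variable {σ K R : Type*} [Fintype σ] [DecidableEq σ] [Field K] [CommRing R] [Algebra K R]

/-- The second order term in the perturbation expansion of the eigenvalue `l i` of
`diagonal l + z • A`. -/
def Matrix.secondOrderShift (A : Matrix σ σ K) (l : σ → K) (i : σ) : K :=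
  ∑ k, A i k ^ 2 / (l i - l k)

lemma Matrix.charpoly_smul_add_diagonal_of_cube_eq_zero {A : Matrix σ σ K} (hsymm : A.IsSymm)
    (hdiag : ∀ i, A i i = 0) {l : σ → K} (hl : Function.Injective l) (g : σ → K) {z : R}
    (hz : z ^ 3 = 0) :
    (z • A.map (algebraMap K R) +
      diagonal fun i => algebraMap K R (l i) + z ^ 2 * algebraMap K R (g i)).charpoly =
    ∏ i, (Polynomial.X - Polynomial.C (algebraMap K R (l i) +
      z ^ 2 * algebraMap K R (g i + secondOrderShift A l i))) := by
  let X : Matrix σ σ K := .of fun i k => - A i k / (l i - l k)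
  let Y : Matrix σ σ K := .of fun i k => - (A * X) i k / (l i - l k)
  let L := diagonal l
  let G := diagonal g
  let S := diagonal (secondOrderShift A l)
  have hX : A + L * X = X * L := by
    ext i k
    rcases eq_or_ne i k with rfl | h
    · simp [X, L, hdiag]
    · have := sub_ne_zero.2 (hl.ne h)
      simp only [X, L, add_apply, diagonal_mul, mul_diagonal, of_apply]
      field_simp
      ring
  have hY : A * X + G + L * Y = Y * L + G + S := by
    ext i k
    rcases eq_or_ne i k with rfl | h
    · have h1 : (A * X) i i = secondOrderShift A l i := by
        rw [mul_apply, secondOrderShift]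
        refine Finset.sum_congr rfl fun k _ => ?_
        rw [show X k i = - A k i / (l k - l i) from rfl, hsymm.apply, ← neg_sub (l i), neg_div_neg_eq]
        ring
      simp only [L, G, S, add_apply, diagonal_mul, mul_diagonal, diagonal_apply_eq, h1]
      ring
    · have := sub_ne_zero.2 (hl.ne h)
      simp only [Y, L, G, S, add_apply, diagonal_mul, mul_diagonal, of_apply,
        diagonal_apply_ne _ h]
      field_simp
      ring
  let φ := (algebraMap K R).mapMatrix (m := σ)
  have hX' := congrArg φ hX
  have hY' := congrArg φ hY
  simp only [map_add, map_mul] at hX' hY'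
  have hU : IsUnit (1 + z • (φ X + z • φ Y)) :=
    IsNilpotent.isUnit_one_add ⟨3, by rw [smul_pow, hz, zero_smul]⟩
  obtain ⟨U, hU⟩ := hU
  have key : (z • φ A + φ L + z ^ 2 • φ G) * U = U * (φ L + z ^ 2 • φ (G + S)) := by
    have h1 : (z • φ A + φ L + z ^ 2 • φ G) * U = φ L + z • (φ A + φ L * φ X) +
        z ^ 2 • (φ A * φ X + φ G + φ L * φ Y) +
        z ^ 3 • (φ A * φ Y + φ G * φ X + z • (φ G * φ Y)) := by
      simp only [hU, mul_add, add_mul, mul_one, smul_add, mul_smul_comm, smul_mul_assoc]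
      module
    have h2 : U * (φ L + z ^ 2 • φ (G + S)) = φ L + z • (φ X * φ L) +
        z ^ 2 • (φ Y * φ L + φ G + φ S) +
        z ^ 3 • (φ X * φ (G + S) + z • (φ Y * φ (G + S))) := by
      simp only [hU, map_add, mul_add, add_mul, one_mul, smul_add, mul_smul_comm, smul_mul_assoc]
      module
    rw [h1, h2, hX', hY', hz, zero_smul, zero_smul]
  have h1 : (z • A.map (algebraMap K R) +
      diagonal fun i => algebraMap K R (l i) + z ^ 2 * algebraMap K R (g i)) =
      z • φ A + φ L + z ^ 2 • φ G := by
    ext i k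
    rcases eq_or_ne i k with rfl | h
    · simp [φ, L, G, add_assoc]
    · simp [φ, L, G, h]
  have h2 : φ L + z ^ 2 • φ (G + S) = diagonal fun i => algebraMap K R (l i) +
      z ^ 2 * algebraMap K R (g i + secondOrderShift A l i) := by
    ext i k
    rcases eq_or_ne i k with rfl | h
    · simp [φ, L, G, S]
    · simp [φ, L, G, S, h]
  rw [h1, ← charpoly_diagonal, ← h2, ← charpoly_units_conj U (φ L + _), ← key,
    mul_nonsing_inv_cancel_right _ _ ((isUnit_iff_isUnit_det _).1 U.isUnit)]

end Perturbation

section Coefficients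

open MvPolynomial

variable {n : ℕ} {K : Type*} [Field K]

/-- The perturbation `X • A + diagonal l` as a matrix of polynomials. -/
noncomputable def Matrix.diagonalDeformation (A : Matrix (Fin n) (Fin n) K) (l : Fin n → K) :
    Matrix (Fin n) (Fin n) (Polynomial K) :=
  (Polynomial.X : Polynomial K) • A.map Polynomial.C + diagonal fun i => Polynomial.C (l i)

/-- The second order correction of the solution attached to the permutation `π`. -/
def Matrix.solutionCorrection (A : Matrix (Fin n) (Fin n) K) (l : Fin n → K)
    (π : Equiv.Perm (Fin n)) (i : Fin n) : K :=
  secondOrderShift A l (π i) - secondOrderShift A (l ∘ π) i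

lemma coeff_two_pairTrace_diagonalDeformation {A : Matrix (Fin n) (Fin n) K} (hsymm : A.IsSymm)
    (hdiag : ∀ i, A i i = 0) {l : Fin n → K} (hl : Function.Injective l) (i j : Fin n) :
    (pairTrace ((Polynomial.X : Polynomial K) • A.map Polynomial.C) (diagonalDeformation A l).charpoly i j).coeff 2 =
      ∑ π : Equiv.Perm (Fin n), (l (π i) * solutionCorrection A l π j +
        l (π j) * solutionCorrection A l π i) := by
  let I : Ideal (Polynomial K) := Ideal.span {Polynomial.X ^ 3}
  let φ : Polynomial K →+* Polynomial K ⧸ I := Ideal.Quotient.mk I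
  have hφC : φ.comp Polynomial.C = algebraMap K (Polynomial K ⧸ I) := rfl
  have hz : φ Polynomial.X ^ 3 = 0 := by
    rw [← map_pow]
    exact Ideal.Quotient.eq_zero_iff_mem.2 (Ideal.mem_span_singleton_self _)
  have hM : ((Polynomial.X : Polynomial K) • A.map Polynomial.C : Matrix (Fin n) (Fin n) (Polynomial K)).map φ =
      φ Polynomial.X • A.map (algebraMap K (Polynomial K ⧸ I)) := by
    ext a b; simp [← hφC]; exact mul_comm _ _
  have hq : (diagonalDeformation A l).charpoly.map φ = (φ Polynomial.X • A.map (algebraMap K _) +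
      diagonal fun i => algebraMap K _ (l i) + φ Polynomial.X ^ 2 * algebraMap K _ 0).charpoly := by
    rw [← charpoly_map, diagonalDeformation]
    congr 1
    ext a b
    rcases eq_or_ne a b with rfl | h
    · simp [← hφC]; exact mul_comm _ _
    · simp [← hφC, h]; exact mul_comm _ _
  let s : Equiv.Perm (Fin n) → Fin n → Polynomial K := fun π a =>
    Polynomial.C (l (π a)) + Polynomial.X ^ 2 * Polynomial.C (solutionCorrection A l π a)
  have hs : ∀ π : Equiv.Perm (Fin n), (φ Polynomial.X • A.map (algebraMap K _) +
      diagonal fun a => φ (s π a)).charpoly = (diagonalDeformation A l).charpoly.map φ := by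
    intro π
    have h1 := charpoly_smul_add_diagonal_of_cube_eq_zero hsymm hdiag (hl.comp π.injective)
      (solutionCorrection A l π) hz
    rw [hq, charpoly_smul_add_diagonal_of_cube_eq_zero hsymm hdiag hl (fun _ => 0) hz,
      ← Equiv.prod_comp π]
    simp only [solutionCorrection, sub_add_cancel, zero_add, Function.comp_apply] at h1 ⊢
    rw [← h1]
    simp [s, ← hφC, solutionCorrection]
  have h1 := pairTrace_map φ ((Polynomial.X : Polynomial K) • A.map Polynomial.C)
    (charpoly_monic (diagonalDeformation A l))
    (by rw [charpoly_natDegree_eq_dim, Fintype.card_fin]) i j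
  have : Nontrivial (Polynomial K ⧸ I) := by
    refine Ideal.Quotient.nontrivial_iff.2 fun h => ?_
    have := (Ideal.eq_top_iff_one _).1 h
    rw [Ideal.mem_span_singleton, Polynomial.X_pow_dvd_iff] at this
    simpa using this 0 (by norm_num)
  rw [hM, pairTrace_eq_sum (ι := Equiv.Perm (Fin n)) (by rw [Fintype.card_perm, Fintype.card_fin])
    ((charpoly_monic _).map φ) (by
      rw [(charpoly_monic _).natDegree_map, charpoly_natDegree_eq_dim, Fintype.card_fin])
    (fun π a => φ (s π a)) hs (fun π π' h => by
      obtain ⟨a, ha⟩ := not_forall.1 fun h' => h (Equiv.ext h')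
      have h2 : φ (s π a) - φ (s π' a) = φ (Polynomial.C (l (π a) - l (π' a))) +
          φ Polynomial.X ^ 2 * φ (Polynomial.C (solutionCorrection A l π a -
            solutionCorrection A l π' a)) := by
        simp only [s, map_add, map_sub, map_mul, map_pow]; ring
      refine ⟨a, ?_⟩
      rw [h2]
      refine IsNilpotent.isUnit_add_left_of_commute ⟨2, ?_⟩ ?_ (Commute.all _ _)
      · rw [mul_pow, ← pow_mul, pow_succ _ 3, hz, zero_mul, zero_mul]
      · exact ((sub_ne_zero.2 (hl.ne ha)).isUnit.map Polynomial.C).map φ)] at h1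
  simp only [← map_mul, ← map_sum] at h1
  rw [Ideal.Quotient.eq, Ideal.mem_span_singleton, Polynomial.X_pow_dvd_iff] at h1
  have h2 := h1 2 (by norm_num)
  rw [Polynomial.coeff_sub, sub_eq_zero] at h2
  rw [← h2, Polynomial.finsetSum_coeff]
  refine Finset.sum_congr rfl fun π _ => ?_
  have h3 : s π i * s π j = Polynomial.C (l (π i) * l (π j)) + Polynomial.X ^ 2 * Polynomial.C
      (l (π i) * solutionCorrection A l π j + l (π j) * solutionCorrection A l π i) +
      Polynomial.X ^ 4 * Polynomial.C
        (solutionCorrection A l π i * solutionCorrection A l π j) := by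
    simp only [s, Polynomial.C_mul, Polynomial.C_add]; ring
  rw [h3]
  simp [Polynomial.coeff_X_pow_mul']

lemma pairTrace_diagonalDeformation_coeff_two_eq_zero [IsAlgClosed K]
    {A : Matrix (Fin n) (Fin n) K}
    (hA : ∀ d : Fin n → K, (A + diagonal d).charpoly = A.charpoly → d = 0) (l : Fin n → K)
    (i j : Fin n) :
    (pairTrace ((Polynomial.X : Polynomial K) • A.map Polynomial.C) (diagonalDeformation A l).charpoly i j).coeff 2 =
      0 := by
  set T := pairTrace ((Polynomial.X : Polynomial K) • A.map Polynomial.C) (diagonalDeformation A l).charpoly i j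
    with hT
  let D : Matrix (Fin n) (Fin n) (Polynomial K) :=
    A.map Polynomial.C + (Polynomial.X : Polynomial K) • diagonal fun i => Polynomial.C (l i)
  let P := pairTrace (A.map Polynomial.C) D.charpoly i j
  have hTz : ∀ z, T.eval z = pairTrace (z • A) (z • A + diagonal l).charpoly i j := by
    intro z
    have h1 : ((Polynomial.X : Polynomial K) • A.map Polynomial.C).map
        (Polynomial.evalRingHom z) = z • A := by
      ext a b; simp; exact mul_comm _ _
    rw [← Polynomial.coe_evalRingHom, hT, ← pairTrace_map _ _ (charpoly_monic _)
      (by rw [charpoly_natDegree_eq_dim, Fintype.card_fin]), ← charpoly_map, h1]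
    congr 2
    · ext a b; rcases eq_or_ne a b with rfl | h
      · simp [diagonalDeformation]; exact mul_comm _ _
      · simp [diagonalDeformation, h]; exact mul_comm _ _
  have hPw : ∀ w, P.eval w = pairTrace A (A + w • diagonal l).charpoly i j := by
    intro w
    rw [← Polynomial.coe_evalRingHom, ← pairTrace_map _ _ (charpoly_monic _)
      (by rw [charpoly_natDegree_eq_dim, Fintype.card_fin]), ← charpoly_map]
    congr 2
    · ext a b; simp
    · ext a b; rcases eq_or_ne a b with rfl | h
      · simp [D]; exact mul_comm _ _
      · simp [D, h]
  have hP0 : P.eval 0 = 0 := by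
    rw [hPw, zero_smul, add_zero, pairTrace_eq_zero hA]
  have hTP : ∀ w, w ≠ 0 → P.eval w = w ^ 2 * T.eval w⁻¹ := by
    intro w hw
    have h1 := pairTrace_smul (mul_inv_cancel₀ hw) (w⁻¹ • A) (w⁻¹ • A + diagonal l) i j
    rw [hPw, hTz, ← h1, smul_add, smul_smul, mul_inv_cancel₀ hw, one_smul]
  have key : Polynomial.X ^ T.natDegree * P = Polynomial.X ^ 2 * Polynomial.reflect T.natDegree T := by
    refine Polynomial.eq_of_infinite_eval_eq _ _ (Set.infinite_of_finite_compl ?_)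
    refine (Set.finite_singleton 0).subset fun w hw => ?_
    by_contra h0
    have h0 : w ≠ 0 := h0
    refine hw ?_
    let _ : Invertible w⁻¹ := invertibleOfNonzero (inv_ne_zero h0)
    have h1 := Polynomial.eval₂_reflect_mul_pow (RingHom.id K) w⁻¹ T.natDegree T le_rfl
    rw [invOf_eq_inv, inv_inv, Polynomial.eval₂_id, Polynomial.eval₂_id] at h1
    simp only [Set.mem_ofPred_eq, Polynomial.eval_mul, Polynomial.eval_pow, Polynomial.eval_X]
    rw [hTP w h0, ← h1, inv_pow]
    field_simp
  rcases lt_or_ge T.natDegree 2 with h | h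
  · exact Polynomial.coeff_eq_zero_of_natDegree_lt h
  have h1 := congrArg (fun p => p.coeff T.natDegree) key
  simp only [Polynomial.coeff_X_pow_mul', le_refl, h, if_true, Nat.sub_self,
    Polynomial.coeff_reflect, Polynomial.revAt_le (Nat.sub_le _ 2), Nat.sub_sub_self h] at h1
  rw [← h1, Polynomial.coeff_zero_eq_eval_zero, hP0]

end Coefficients

section PermutationSums

variable {σ K : Type*} [Fintype σ] [DecidableEq σ] [Field K]

lemma Equiv.Perm.sum_apply_apply_eq {M : Type*} [AddCommMonoid M] (f : σ → σ → M) {i j i' j' : σ}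
    (h : i ≠ j) (h' : i' ≠ j') :
    ∑ π : Equiv.Perm σ, f (π i) (π j) = ∑ π : Equiv.Perm σ, f (π i') (π j') := by
  obtain ⟨τ, hi, hj⟩ := (MulAction.is_two_pretransitive_iff (G := Equiv.Perm σ) (α := σ)).1
    (Equiv.Perm.isMultiplyPretransitive σ 2) h h'
  rw [Equiv.Perm.smul_def] at hi hj
  rw [← Equiv.sum_comp (Equiv.mulRight τ)]
  simp [hi, hj]

variable [CharZero K]

lemma sum_mul_secondOrderShift_comp (A : Matrix σ σ K) (l : σ → K) {i j : σ} (h : i ≠ j) :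
    ∑ π : Equiv.Perm σ, l (π i) * secondOrderShift A (l ∘ π) j =
      A j i ^ 2 * ∑ π : Equiv.Perm σ, l (π i) / (l (π j) - l (π i)) := by
  simp only [secondOrderShift, Finset.mul_sum, Function.comp_apply]
  rw [Finset.sum_comm, Finset.sum_eq_single i _ (fun h => absurd (Finset.mem_univ i) h)]
  · exact Finset.sum_congr rfl fun π _ => by ring
  intro k _ hk
  rw [← self_eq_neg, ← Finset.sum_neg_distrib]
  nth_rw 1 [← Equiv.sum_comp (Equiv.mulRight (Equiv.swap j k))]
  refine Finset.sum_congr rfl fun π _ => ?_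
  simp only [Equiv.coe_mulRight, Equiv.Perm.mul_apply, Equiv.swap_apply_left,
    Equiv.swap_apply_right, Equiv.swap_apply_of_ne_of_ne h hk.symm]
  rw [← neg_sub (l (π j)), div_neg, mul_neg]

lemma sum_mul_secondOrderShift_add {A : Matrix σ σ K} (hsymm : A.IsSymm) {l : σ → K}
    (hl : Function.Injective l) {i j : σ} (h : i ≠ j) :
    ∑ π : Equiv.Perm σ, (l (π i) * secondOrderShift A (l ∘ π) j +
      l (π j) * secondOrderShift A (l ∘ π) i) = - ((Fintype.card σ).factorial * A i j ^ 2) := by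
  rw [Finset.sum_add_distrib, sum_mul_secondOrderShift_comp A l h,
    sum_mul_secondOrderShift_comp A l h.symm, hsymm.apply, ← mul_add, ← Finset.sum_add_distrib,
    Finset.sum_congr rfl fun π _ => show _ = (-1 : K) by
      have h1 := sub_ne_zero.2 (hl.ne (π.injective.ne h))
      have h2 := sub_ne_zero.2 (hl.ne (π.injective.ne h.symm))
      field_simp
      ring]
  simp [Fintype.card_perm, mul_comm]

end PermutationSums

/-- If an off-diagonal symmetric matrix has no nontrivial isospectral diagonal perturbation, then
the squares of its off-diagonal entries are equal. -/
lemma Matrix.sq_eq_sq_of_forall_isospectral_diagonal_eq_zero {n : ℕ} {K : Type*} [Field K]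
    [IsAlgClosed K] [CharZero K] {A : Matrix (Fin n) (Fin n) K} (hsymm : A.IsSymm)
    (hdiag : ∀ i, A i i = 0)
    (hA : ∀ d : Fin n → K, (A + diagonal d).charpoly = A.charpoly → d = 0) {i j i' j' : Fin n}
    (h : i ≠ j) (h' : i' ≠ j') : A i j ^ 2 = A i' j' ^ 2 := by
  let l : Fin n → K := fun i => (i : ℕ)
  have hl : Function.Injective l := Nat.cast_injective.comp Fin.val_injective
  let f : Fin n → Fin n → K := fun a b =>
    l a * secondOrderShift A l b + l b * secondOrderShift A l a
  have key : ∀ a b, a ≠ b →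
      ∑ π : Equiv.Perm (Fin n), f (π a) (π b) + n.factorial * A a b ^ 2 = 0 := by
    intro a b hab
    have h1 := coeff_two_pairTrace_diagonalDeformation hsymm hdiag hl a b
    have h2 := sum_mul_secondOrderShift_add hsymm hl hab
    rw [pairTrace_diagonalDeformation_coeff_two_eq_zero hA] at h1
    rw [Fintype.card_fin] at h2
    rw [← sub_neg_eq_add, ← h2, h1, ← Finset.sum_sub_distrib]
    refine Finset.sum_congr rfl fun π _ => ?_
    simp only [f, solutionCorrection]
    ring
  have h1 := (key i j h).trans (key i' j' h').symm
  rw [Equiv.Perm.sum_apply_apply_eq f h h', add_right_inj] at h1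
  exact mul_left_cancel₀ (Nat.cast_ne_zero.2 n.factorial_ne_zero) h1

/-- Corollary B: let `A` be the adjacency matrix of a weighted simple graph on `n`
vertices over `ℂ` (i.e. `A` is symmetric with zero diagonal).  If the graph is
neither edgeless (`A ≠ 0`) nor complete with all edge weights equal up to sign,
then there is a nonzero diagonal matrix `D` such that `A` and `A + D` have the
same spectrum (equivalently, the same characteristic polynomial). -/
theorem exists_isospectral_diagonal_of_adjacency
    {n : ℕ} (A : Matrix (Fin n) (Fin n) ℂ)
    (hsymm : A.IsSymm) (hdiag : ∀ i, A i i = 0)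
    (h_not_edgeless : A ≠ 0)
    (h_not_complete : ¬ ∃ w : ℂ, w ≠ 0 ∧ ∀ i j : Fin n, i ≠ j →
      A i j = w ∨ A i j = -w) :
    ∃ d : Fin n → ℂ, d ≠ 0 ∧ (A + Matrix.diagonal d).charpoly = A.charpoly := by
  by_contra! hA
  obtain ⟨i, j, hij⟩ : ∃ i j, A i j ≠ 0 := by
    by_contra! h
    exact h_not_edgeless (Matrix.ext h)
  have hne : i ≠ j := by
    rintro rfl
    exact hij (hdiag i)
  refine h_not_complete ⟨A i j, hij, fun a b hab => sq_eq_sq_iff_eq_or_eq_neg.1 ?_⟩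
  refine sq_eq_sq_of_forall_isospectral_diagonal_eq_zero hsymm hdiag (fun d hd => ?_) hab hne
  by_contra h
  exact hA d h hd
end

section
/- Let g_1,…,g_n ∈ K[v_1,…,v_n] with deg(g_i) < i for each i. Then e_1+g_1, …, e_n+g_n form a regular sequence in K[v_1,…,v_n], and the quotient K[v_1,…,v_n]/(e_1+g_1,…,e_n+g_n) has dimension n! as a K-vector space. -/
open MvPolynomial

section ShiftBasis

variable {K R ι σ : Type*} [Field K] [CommRing R] [Algebra K R]
  {b : Module.Basis (ι × (σ →₀ ℕ)) K R} {f : σ → R}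

lemma repr_mul_add_single (hb : ∀ a m i, f i * b (a, m) = b (a, m + Finsupp.single i 1))
    (i : σ) (r : R) (a : ι) (m : σ →₀ ℕ) :
    b.repr (f i * r) (a, m + Finsupp.single i 1) = b.repr r (a, m) := by
  classical
  have h : (Finsupp.lapply (a, m + Finsupp.single i 1) ∘ₗ b.repr.toLinearMap) ∘ₗ
      LinearMap.mulLeft K (f i) = Finsupp.lapply (a, m) ∘ₗ b.repr.toLinearMap := by
    refine b.ext fun ⟨a', m'⟩ => ?_
    simp [hb, Finsupp.single_apply]
  exact LinearMap.congr_fun h r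

lemma repr_mul_eq_zero (hb : ∀ a m i, f i * b (a, m) = b (a, m + Finsupp.single i 1))
    (i : σ) (r : R) (a : ι) (m : σ →₀ ℕ) (hm : m i = 0) :
    b.repr (f i * r) (a, m) = 0 := by
  classical
  have h : (Finsupp.lapply (a, m) ∘ₗ b.repr.toLinearMap) ∘ₗ LinearMap.mulLeft K (f i) = 0 := by
    refine b.ext fun ⟨a', m'⟩ => ?_
    have : m' + Finsupp.single i 1 ≠ m := by
      rintro rfl
      simp at hm
    simp [hb, this]
  exact LinearMap.congr_fun h r

lemma mem_span_image_iff_repr_eq_zero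
    (hb : ∀ a m i, f i * b (a, m) = b (a, m + Finsupp.single i 1)) (s : Set σ) (r : R) :
    r ∈ Ideal.span (f '' s) ↔ ∀ a m, (∀ i ∈ s, m i = 0) → b.repr r (a, m) = 0 := by
  constructor
  · intro hr
    suffices h : ∀ t a m, (∀ i ∈ s, m i = 0) → b.repr (t * r) (a, m) = 0 by simpa using h 1
    induction hr using Submodule.span_induction with
    | mem x hx =>
      obtain ⟨i, hi, rfl⟩ := hx
      intro t a m hm
      rw [mul_comm]
      exact repr_mul_eq_zero hb i t a m (hm i hi)
    | zero => simp
    | add x y _ _ hx hy =>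
      intro t a m hm
      simp [mul_add, hx t a m hm, hy t a m hm]
    | smul u x _ hx =>
      intro t a m hm
      rw [smul_eq_mul, ← mul_assoc]
      exact hx _ a m hm
  · intro h
    rw [← b.linearCombination_repr r, Finsupp.linearCombination_apply]
    refine Submodule.sum_mem _ fun ⟨a, m⟩ ham => Submodule.smul_of_tower_mem _ _ ?_
    obtain ⟨i, hi, hmi⟩ : ∃ i ∈ s, m i ≠ 0 := by
      by_contra! hm
      exact Finsupp.mem_support_iff.mp ham (h a m hm)
    have hle : Finsupp.single i 1 ≤ m := by
      simpa [Finsupp.single_le_iff] using Nat.one_le_iff_ne_zero.mpr hmi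
    rw [← tsub_add_cancel_of_le hle, ← hb]
    exact Ideal.mul_mem_right _ _ (Ideal.subset_span ⟨i, hi, rfl⟩)

lemma finrank_quotient_span_range [Fintype ι]
    (hb : ∀ a m i, f i * b (a, m) = b (a, m + Finsupp.single i 1)) :
    Module.finrank K (R ⧸ Ideal.span (Set.range f)) = Fintype.card ι := by
  let φ : R →ₗ[K] (ι → K) :=
    LinearMap.pi fun a => Finsupp.lapply (a, (0 : σ →₀ ℕ)) ∘ₗ b.repr.toLinearMap
  have hker : LinearMap.ker φ = (Ideal.span (Set.range f)).restrictScalars K := by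
    ext r
    rw [Submodule.restrictScalars_mem, ← Set.image_univ, mem_span_image_iff_repr_eq_zero hb]
    constructor
    · intro hr a m hm
      obtain rfl : m = 0 := Finsupp.ext fun i => hm i trivial
      exact congrFun (LinearMap.mem_ker.mp hr) a
    · exact fun hr => LinearMap.mem_ker.mpr (funext fun a => hr a 0 fun _ _ => rfl)
  have hsurj : Function.Surjective φ := by
    classical
    intro c
    refine ⟨∑ a, c a • b (a, 0), funext fun a => ?_⟩
    simp [φ, Finsupp.single_apply]
  have e := φ.quotKerEquivOfSurjective hsurj
  rw [hker] at e
  rw [← Module.finrank_fintype_fun_eq_card K (η := ι)]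
  exact LinearEquiv.finrank_eq e

lemma isRegular_ofFn [Nonempty ι] {n : ℕ} {b : Module.Basis (ι × (Fin n →₀ ℕ)) K R}
    {f : Fin n → R} (hb : ∀ a m i, f i * b (a, m) = b (a, m + Finsupp.single i 1)) :
    RingTheory.Sequence.IsRegular R (List.ofFn f) := by
  have hofList (k : ℕ) : Ideal.ofList ((List.ofFn f).take k) =
      Ideal.span (f '' {i | (i : ℕ) < k}) := by
    refine congrArg Ideal.span (Set.ext fun r => ?_)
    simp only [Set.mem_ofPred_eq, List.mem_take_iff_getElem, List.length_ofFn, List.getElem_ofFn,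
      Set.mem_image]
    constructor
    · rintro ⟨j, hj, rfl⟩
      exact ⟨⟨j, by omega⟩, by simp; omega, rfl⟩
    · rintro ⟨j, hj, rfl⟩
      exact ⟨j, by omega, rfl⟩
  refine { regular_mod_prev := fun k hk => ?_, top_ne_smul := fun h => ?_ }
  · rw [isSMulRegular_quotient_iff_mem_of_smul_mem]
    have hkn : k < n := by simpa using hk
    intro r hr
    simp only [smul_eq_mul, Ideal.mul_top, hofList, List.getElem_ofFn] at hr ⊢
    rw [mem_span_image_iff_repr_eq_zero hb] at hr ⊢
    intro a m hm
    rw [← repr_mul_add_single hb ⟨k, hkn⟩]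
    refine hr _ _ fun i hi => ?_
    have hne : (⟨k, hkn⟩ : Fin n) ≠ i := by
      rintro rfl
      simp at hi
    simp [hm i hi, hne]
  · have h1 : b (Classical.arbitrary ι, 0) ∈ Ideal.ofList ((List.ofFn f).take n) := by
      rw [List.take_of_length_le (by simp)]
      rw [smul_eq_mul, Ideal.mul_top] at h
      rw [← h]
      trivial
    rw [hofList, mem_span_image_iff_repr_eq_zero hb] at h1
    simpa using h1 (Classical.arbitrary ι) 0 fun _ _ => rfl

end ShiftBasis

section Filtration

variable {K σ : Type*} [Field K]

variable (K σ) in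
/-- The polynomials of degree less than `d`; for `d = 0` this is the zero submodule. -/
noncomputable def degreeFiltration (d : ℕ) : Submodule K (MvPolynomial σ K) :=
  restrictSupport K {m | m.degree < d}

lemma mem_degreeFiltration {d : ℕ} {p : MvPolynomial σ K} :
    p ∈ degreeFiltration K σ d ↔ ∀ m ∈ p.support, m.degree < d := by
  rw [degreeFiltration, mem_restrictSupport_iff]
  rfl

lemma degreeFiltration_mono : Monotone (degreeFiltration K σ) := fun _ _ h =>
  restrictSupport_mono _ fun _ hm => lt_of_lt_of_le hm h

lemma degreeFiltration_zero : degreeFiltration K σ 0 = ⊥ := by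
  refine (Submodule.eq_bot_iff _).mpr fun p hp => ?_
  rw [mem_degreeFiltration] at hp
  exact support_eq_empty.mp (Finset.eq_empty_of_forall_notMem fun m hm => by simpa using hp m hm)

lemma mem_degreeFiltration_of_totalDegree_lt {d : ℕ} {p : MvPolynomial σ K}
    (hp : p.totalDegree < d) : p ∈ degreeFiltration K σ d :=
  mem_degreeFiltration.mpr fun _ hm => (le_totalDegree hm).trans_lt hp

lemma MvPolynomial.IsHomogeneous.mem_degreeFiltration {d : ℕ} {p : MvPolynomial σ K}
    (hp : p.IsHomogeneous d) : p ∈ degreeFiltration K σ (d + 1) :=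
  mem_degreeFiltration_of_totalDegree_lt (Nat.lt_succ_of_le hp.totalDegree_le)

lemma mul_mem_degreeFiltration {d e : ℕ} {p q : MvPolynomial σ K}
    (hp : p ∈ degreeFiltration K σ (d + 1)) (hq : q ∈ degreeFiltration K σ e) :
    p * q ∈ degreeFiltration K σ (d + e) := by
  classical
  rw [mem_degreeFiltration] at *
  intro m hm
  obtain ⟨u, hu, v, hv, rfl⟩ := Finset.mem_add.mp (support_mul p q hm)
  have := hp u hu
  have := hq v hv
  rw [map_add]
  omega

/-- `p` has degree at most `d` and `q` agrees with `p` in degree `d`. -/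
def SameLeadingForm (d : ℕ) (p q : MvPolynomial σ K) : Prop :=
  p ∈ degreeFiltration K σ (d + 1) ∧ q - p ∈ degreeFiltration K σ d

namespace SameLeadingForm

variable {d e : ℕ} {p q p' q' : MvPolynomial σ K}

lemma refl_of_isHomogeneous (hp : p.IsHomogeneous d) : SameLeadingForm d p p :=
  ⟨hp.mem_degreeFiltration, by simp⟩

lemma mul (h : SameLeadingForm d p q) (h' : SameLeadingForm e p' q') :
    SameLeadingForm (d + e) (p * p') (q * q') := by
  refine ⟨by simpa only [add_assoc] using mul_mem_degreeFiltration h.1 h'.1, ?_⟩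
  have hq' : q' ∈ degreeFiltration K σ (e + 1) := by
    rw [← sub_add_cancel q' p']
    exact add_mem (degreeFiltration_mono e.le_succ h'.2) h'.1
  have h1 := mul_mem_degreeFiltration h.1 h'.2
  have h2 := mul_mem_degreeFiltration hq' h.2
  rw [add_comm e d] at h2
  convert add_mem h1 h2 using 1
  ring

lemma pow (h : SameLeadingForm d p q) (k : ℕ) : SameLeadingForm (k * d) (p ^ k) (q ^ k) := by
  induction k with
  | zero => simpa using refl_of_isHomogeneous (isHomogeneous_one σ K)
  | succ k ih => simpa [pow_succ, add_mul] using ih.mul h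

lemma prod {ι : Type*} (s : Finset ι) {d : ι → ℕ} {p q : ι → MvPolynomial σ K}
    (h : ∀ i ∈ s, SameLeadingForm (d i) (p i) (q i)) :
    SameLeadingForm (∑ i ∈ s, d i) (∏ i ∈ s, p i) (∏ i ∈ s, q i) := by
  classical
  induction s using Finset.induction_on with
  | empty => simpa using refl_of_isHomogeneous (isHomogeneous_one σ K)
  | insert a s ha ih =>
    simp only [Finset.sum_insert ha, Finset.prod_insert ha]
    exact (h a (by simp)).mul (ih fun i hi => h i (by simp [hi]))

end SameLeadingForm

lemma repr_homogeneousComponent {J : Type*} (b : Module.Basis J K (MvPolynomial σ K)) (w : J → ℕ)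
    (hb : ∀ j, (b j).IsHomogeneous (w j)) (i : ℕ) (p : MvPolynomial σ K) (j : J) :
    b.repr (homogeneousComponent i p) j = if w j = i then b.repr p j else 0 := by
  classical
  have h : (Finsupp.lapply j ∘ₗ b.repr.toLinearMap) ∘ₗ homogeneousComponent i =
      if w j = i then Finsupp.lapply j ∘ₗ b.repr.toLinearMap else 0 := by
    refine b.ext fun l => ?_
    have hl := homogeneousComponent_of_mem (m := i) ((mem_homogeneousSubmodule _ _).mpr (hb l))
    rcases eq_or_ne l j with rfl | hlj <;> rcases eq_or_ne (w l) i with rfl | hi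
    · simp [hl]
    · simp [hl, hi, hi.symm]
    · split_ifs <;> simp [hl, hlj]
    · split_ifs <;> simp [hl, hlj, hi.symm]
  have := LinearMap.congr_fun h p
  split_ifs at this ⊢ <;> simpa using this

lemma lt_of_repr_ne_zero {J : Type*} (b : Module.Basis J K (MvPolynomial σ K)) (w : J → ℕ)
    (hb : ∀ j, (b j).IsHomogeneous (w j)) {d : ℕ} {p : MvPolynomial σ K}
    (hp : p ∈ degreeFiltration K σ d) {j : J} (hj : b.repr p j ≠ 0) : w j < d := by
  by_contra! hd
  have h0 : homogeneousComponent (w j) p = 0 :=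
    homogeneousComponent_eq_zero' _ _ fun m hm =>
      ((mem_degreeFiltration.mp hp m hm).trans_le hd).ne
  have := repr_homogeneousComponent b w hb (w j) p j
  simp [h0] at this
  exact hj this.symm

lemma bijective_of_sub_mem_degreeFiltration
    (T : MvPolynomial σ K →ₗ[K] MvPolynomial σ K)
    (hT : ∀ d, ∀ p ∈ degreeFiltration K σ (d + 1), T p - p ∈ degreeFiltration K σ d) :
    Function.Bijective T := by
  have hmem (p : MvPolynomial σ K) : ∃ d, p ∈ degreeFiltration K σ d :=
    ⟨_, mem_degreeFiltration_of_totalDegree_lt (Nat.lt_succ_self p.totalDegree)⟩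
  constructor
  · refine (injective_iff_map_eq_zero T).mpr fun p hp => ?_
    obtain ⟨d, hd⟩ := hmem p
    induction d with
    | zero => simpa [degreeFiltration_zero] using hd
    | succ d ih => exact ih (by simpa [hp] using hT d p hd)
  · intro p
    obtain ⟨d, hd⟩ := hmem p
    induction d generalizing p with
    | zero =>
      rw [degreeFiltration_zero, Submodule.mem_bot] at hd
      exact ⟨0, by simp [hd]⟩
    | succ d ih =>
      obtain ⟨q, hq⟩ := ih _ (hT d p hd)
      exact ⟨p - q, by simp [hq]⟩

lemma exists_basis_of_sameLeadingForm {J : Type*} (b : Module.Basis J K (MvPolynomial σ K))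
    (w : J → ℕ) (hb : ∀ j, (b j).IsHomogeneous (w j)) (q : J → MvPolynomial σ K)
    (hq : ∀ j, SameLeadingForm (w j) (b j) (q j)) :
    ∃ b' : Module.Basis J K (MvPolynomial σ K), ∀ j, b' j = q j := by
  let T : MvPolynomial σ K →ₗ[K] MvPolynomial σ K := b.constr K q
  have hT : Function.Bijective T := by
    refine bijective_of_sub_mem_degreeFiltration T fun d p hp => ?_
    have : T p - p = (b.repr p).sum fun j c => c • (q j - b j) := by
      conv_lhs => rw [← b.linearCombination_repr p]
      simp [T, Finsupp.linearCombination_apply, map_finsuppSum, smul_sub, Finsupp.sum_sub]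
    rw [this]
    refine Submodule.sum_mem _ fun j hj => Submodule.smul_mem _ _ ?_
    exact degreeFiltration_mono
      (Nat.le_of_lt_succ (lt_of_repr_ne_zero b w hb hp (Finsupp.mem_support_iff.mp hj))) (hq j).2
  exact ⟨b.map (LinearEquiv.ofBijective T hT), fun j => by simp [T]⟩

end Filtration

section StaircaseBasis

variable {K : Type*} [Field K]

/-- The family `x` is a basis of `R` as a module over the subalgebra `A`. -/
def IsBasisOver {R ι : Type*} [CommRing R] [Algebra K R] [Fintype ι] (A : Subalgebra K R)
    (x : ι → R) : Prop :=
  Function.Bijective fun c : ι → A => ∑ i, (c i : R) * x i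

lemma IsBasisOver.tower {R ι κ : Type*} [CommRing R] [Algebra K R] [Fintype ι] [Fintype κ]
    {A B : Subalgebra K R} {x : ι → R} {y : κ → R} (hx : IsBasisOver A x)
    (hmem : ∀ c : κ → B, ∑ j, (c j : R) * y j ∈ A)
    (hinj : ∀ c : κ → B, ∑ j, (c j : R) * y j = 0 → c = 0)
    (hsurj : ∀ p ∈ A, ∃ c : κ → B, ∑ j, (c j : R) * y j = p) :
    IsBasisOver B fun ij : ι × κ => x ij.1 * y ij.2 := by
  have hsum (c : ι × κ → B) : ∑ ij, (c ij : R) * (x ij.1 * y ij.2) =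
      ∑ i, (∑ j, (c (i, j) : R) * y j) * x i := by
    rw [Fintype.sum_prod_type]
    refine Finset.sum_congr rfl fun i _ => ?_
    rw [Finset.sum_mul]
    exact Finset.sum_congr rfl fun j _ => by ring
  constructor
  · intro c c' h
    simp only [hsum] at h
    have hcoeff := @hx.1 (fun i => ⟨_, hmem fun j => c (i, j)⟩)
      (fun i => ⟨_, hmem fun j => c' (i, j)⟩) h
    funext ⟨i, j⟩
    have hi := congrArg Subtype.val (congrFun hcoeff i)
    have hsub := hinj (fun j => c (i, j) - c' (i, j)) (by
      simpa [sub_mul, sub_eq_zero] using hi)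
    exact sub_eq_zero.mp (congrFun hsub j)
  · intro p
    obtain ⟨a, ha⟩ := hx.2 p
    choose c hc using fun i => hsurj (a i) (a i).2
    refine ⟨fun ij => c ij.1 ij.2, ?_⟩
    simp only [hsum, hc]
    exact ha

variable (K) in
/-- The subalgebra generated by the elementary symmetric polynomials and by the variables
of index at least `k`. -/
noncomputable def esymmTailAdjoin (n k : ℕ) : Subalgebra K (MvPolynomial (Fin n) K) :=
  Algebra.adjoin K
    (Set.range (fun i : Fin n => esymm (Fin n) K ((i : ℕ) + 1)) ∪ X '' {j : Fin n | k ≤ j})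

variable {n k : ℕ}

lemma esymm_mem_esymmTailAdjoin (j : ℕ) : esymm (Fin n) K j ∈ esymmTailAdjoin K n k := by
  rcases j with _ | j
  · simp
  · by_cases hj : j < n
    · exact Algebra.subset_adjoin (Or.inl ⟨⟨j, hj⟩, rfl⟩)
    · have : esymm (Fin n) K (j + 1) = 0 := by
        rw [esymm, Finset.powersetCard_eq_empty.mpr (by simp; omega), Finset.sum_empty]
      rw [this]
      exact zero_mem _

lemma X_mem_esymmTailAdjoin {j : Fin n} (hj : k ≤ j) :
    (X j : MvPolynomial (Fin n) K) ∈ esymmTailAdjoin K n k :=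
  Algebra.subset_adjoin (Or.inr ⟨j, hj, rfl⟩)

lemma esymmTailAdjoin_zero : esymmTailAdjoin K n 0 = ⊤ := by
  rw [eq_top_iff, ← adjoin_range_X]
  refine Algebra.adjoin_le ?_
  rintro _ ⟨j, rfl⟩
  exact X_mem_esymmTailAdjoin (Nat.zero_le _)

lemma esymmTailAdjoin_self :
    esymmTailAdjoin K n n = (aeval fun i : Fin n => esymm (Fin n) K ((i : ℕ) + 1)).range := by
  rw [← Algebra.adjoin_range_eq_range_aeval, esymmTailAdjoin]
  have : {j : Fin n | n ≤ j} = ∅ := Set.eq_empty_of_forall_notMem fun j hj => not_le.mpr j.2 hj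
  simp [this]

lemma esymmTailAdjoin_succ_le : esymmTailAdjoin K n (k + 1) ≤ esymmTailAdjoin K n k :=
  Algebra.adjoin_mono (Set.union_subset_union_right _ (Set.image_mono fun _ hj =>
    (Nat.le_succ k).trans hj))

lemma rename_eq_self_of_mem_esymmTailAdjoin (e : Equiv.Perm (Fin n))
    (he : ∀ j : Fin n, k ≤ j → e j = j) {p : MvPolynomial (Fin n) K}
    (hp : p ∈ esymmTailAdjoin K n k) : rename e p = p := by
  suffices h : esymmTailAdjoin K n k ≤ AlgHom.equalizer (rename e) (AlgHom.id K _) from h hp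
  refine Algebra.adjoin_le ?_
  rintro _ (⟨i, rfl⟩ | ⟨j, hj, rfl⟩)
  · exact rename_esymm _ _ _ e
  · simp [he j hj]

lemma exists_aeval_eq_of_mem_esymmTailAdjoin (hk : k < n) {p : MvPolynomial (Fin n) K}
    (hp : p ∈ esymmTailAdjoin K n k) :
    ∃ q : Polynomial (esymmTailAdjoin K n (k + 1)),
      Polynomial.aeval (X ⟨k, hk⟩ : MvPolynomial (Fin n) K) q = p := by
  let A := esymmTailAdjoin K n (k + 1)
  suffices h : esymmTailAdjoin K n k ≤
      ((Polynomial.aeval (R := A) (X ⟨k, hk⟩ : MvPolynomial (Fin n) K)).range).restrictScalars K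
    from h hp
  refine Algebra.adjoin_le ?_
  rintro _ (⟨i, rfl⟩ | ⟨j, hj, rfl⟩)
  · exact ⟨Polynomial.C ⟨_, esymm_mem_esymmTailAdjoin ((i : ℕ) + 1)⟩, Polynomial.aeval_C _ _⟩
  · rcases eq_or_lt_of_le (show k ≤ (j : ℕ) from hj) with rfl | h
    · exact ⟨Polynomial.X, by simp⟩
    · exact ⟨Polynomial.C ⟨_, X_mem_esymmTailAdjoin h⟩, Polynomial.aeval_C _ _⟩

lemma exists_monic_aeval_eq_zero (hk : k < n) :
    ∃ P : Polynomial (esymmTailAdjoin K n (k + 1)), P.Monic ∧ P.natDegree = k + 1 ∧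
      Polynomial.aeval (X ⟨k, hk⟩ : MvPolynomial (Fin n) K) P = 0 := by
  classical
  let A := esymmTailAdjoin K n (k + 1)
  let lin : Fin n → Polynomial (MvPolynomial (Fin n) K) := fun i =>
    Polynomial.X - Polynomial.C (X i)
  let s : Finset (Fin n) := Finset.univ.filter fun i => (i : ℕ) < k + 1
  have hall : (∏ i, lin i) ∈ Polynomial.lifts (algebraMap A (MvPolynomial (Fin n) K)) := by
    have h := Multiset.prod_X_sub_X_eq_sum_esymm
      (Finset.univ.val.map fun i : Fin n => (X i : MvPolynomial (Fin n) K))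
    rw [Multiset.map_map] at h
    change ∏ i, lin i = _ at h
    rw [h]
    refine Subsemiring.sum_mem _ fun j _ => ?_
    rw [← aeval_esymm_eq_multiset_esymm (Fin n) K]
    refine mul_mem (pow_mem ?_ _) (mul_mem ?_ (pow_mem ?_ _))
    · exact (Polynomial.mem_lifts _).mpr ⟨-1, by simp⟩
    · refine (Polynomial.mem_lifts _).mpr
        ⟨Polynomial.C ⟨_, esymm_mem_esymmTailAdjoin j⟩, ?_⟩
      rw [Polynomial.map_C]
      exact congrArg Polynomial.C (aeval_X_left_apply _).symm
    · exact (Polynomial.mem_lifts _).mpr ⟨Polynomial.X, by simp⟩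
  obtain ⟨F, hF⟩ := (Polynomial.mem_lifts _).mp hall
  let G : Polynomial A := ∏ i : {i // i ∉ s},
    (Polynomial.X - Polynomial.C ⟨X i.1, X_mem_esymmTailAdjoin (by simpa [s] using i.2)⟩)
  have hG : G.Monic := Polynomial.monic_prod_of_monic _ _ fun i _ => Polynomial.monic_X_sub_C _
  have hGmap : G.map (algebraMap A (MvPolynomial (Fin n) K)) = ∏ i ∈ sᶜ, lin i := by
    rw [Finset.prod_subtype sᶜ (fun _ => Finset.mem_compl) lin, Polynomial.map_prod]
    refine Finset.prod_congr rfl fun i _ => ?_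
    rw [Polynomial.map_sub, Polynomial.map_X, Polynomial.map_C]
    rfl
  have hmap : (F /ₘ G).map (algebraMap A (MvPolynomial (Fin n) K)) = ∏ i ∈ s, lin i := by
    rw [Polynomial.map_divByMonic _ hG, hF, hGmap, ← Finset.prod_compl_mul_prod s]
    exact Polynomial.mul_divByMonic_cancel_left _
      (Polynomial.monic_prod_of_monic _ _ fun i _ => Polynomial.monic_X_sub_C _)
  have hinj : Function.Injective (algebraMap A (MvPolynomial (Fin n) K)) := Subtype.val_injective
  refine ⟨F /ₘ G, ?_, ?_, ?_⟩
  · refine Polynomial.monic_of_injective hinj ?_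
    rw [hmap]
    exact Polynomial.monic_prod_of_monic _ _ fun i _ => Polynomial.monic_X_sub_C _
  · rw [← Polynomial.natDegree_map_eq_of_injective hinj, hmap,
      Polynomial.natDegree_finsetProd_X_sub_C_eq_card]
    exact Fin.card_filter_val_lt.trans (min_eq_right hk)
  · rw [← Polynomial.eval_map_algebraMap, hmap, Polynomial.eval_prod]
    exact Finset.prod_eq_zero (i := ⟨k, hk⟩) (by simp [s]) (by simp [lin])

lemma exists_sum_eq_of_mem_esymmTailAdjoin (hk : k < n) {p : MvPolynomial (Fin n) K}
    (hp : p ∈ esymmTailAdjoin K n k) :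
    ∃ c : Fin (k + 1) → esymmTailAdjoin K n (k + 1),
      ∑ j, (c j : MvPolynomial (Fin n) K) * X ⟨k, hk⟩ ^ (j : ℕ) = p := by
  obtain ⟨q, rfl⟩ := exists_aeval_eq_of_mem_esymmTailAdjoin hk hp
  obtain ⟨P, hP, hdeg, hroot⟩ := exists_monic_aeval_eq_zero (K := K) hk
  refine ⟨fun j => (q %ₘ P).coeff j, ?_⟩
  have hlt : (q %ₘ P).natDegree < k + 1 := by
    refine (Polynomial.natDegree_modByMonic_lt q hP ?_).trans_eq hdeg
    rintro rfl
    simp at hdeg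
  conv_rhs => rw [← Polynomial.modByMonic_add_div q P]
  rw [map_add, map_mul, hroot, zero_mul, add_zero, Polynomial.aeval_eq_sum_range' hlt,
    Finset.sum_range]
  rfl

lemma eq_zero_of_sum_eq_zero (hk : k < n) (c : Fin (k + 1) → esymmTailAdjoin K n (k + 1))
    (hc : ∑ j, (c j : MvPolynomial (Fin n) K) * X ⟨k, hk⟩ ^ (j : ℕ) = 0) : c = 0 := by
  let q : Polynomial (MvPolynomial (Fin n) K) :=
    ∑ j : Fin (k + 1), Polynomial.monomial (j : ℕ) (c j : MvPolynomial (Fin n) K)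
  have hcoeff (j : Fin (k + 1)) : q.coeff j = c j := by
    simp [q, Polynomial.finsetSum_coeff, Polynomial.coeff_monomial, Fin.val_inj]
  have hq : q = 0 := by
    refine Polynomial.eq_zero_of_natDegree_lt_card_of_eval_eq_zero q
      (f := fun i : Fin (k + 1) => (X (Fin.castLE hk i) : MvPolynomial (Fin n) K))
      ((X_injective).comp (Fin.castLE_injective _)) (fun i => ?_) ?_
    · have h := congrArg (rename (Equiv.swap ⟨k, hk⟩ (Fin.castLE hk i))) hc
      have hfix (j : Fin (k + 1)) :
          rename (Equiv.swap ⟨k, hk⟩ (Fin.castLE hk i)) (c j : MvPolynomial (Fin n) K) = c j := by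
        refine rename_eq_self_of_mem_esymmTailAdjoin _ (fun l hl => ?_) (c j).2
        refine Equiv.swap_apply_of_ne_of_ne ?_ ?_
        · rintro rfl
          simp at hl
        · rintro rfl
          exact absurd i.2 (not_lt.mpr hl)
      simpa [q, hfix, Polynomial.eval_finsetSum] using h
    · rw [Fintype.card_fin, Nat.lt_succ_iff]
      refine Polynomial.natDegree_sum_le_of_forall_le _ _ fun j _ => ?_
      exact (Polynomial.natDegree_monomial_le _).trans (Nat.le_of_lt_succ j.2)
  funext j
  exact Subtype.ext (by simp [← hcoeff, hq])

lemma exists_isBasisOver_esymmTailAdjoin (hk : k ≤ n) :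
    ∃ (ι : Type) (_ : Fintype ι) (d : ι → ℕ) (x : ι → MvPolynomial (Fin n) K),
      Fintype.card ι = k.factorial ∧ (∀ i, (x i).IsHomogeneous (d i)) ∧
        IsBasisOver (esymmTailAdjoin K n k) x := by
  induction k with
  | zero =>
    refine ⟨Unit, inferInstance, fun _ => 0, fun _ => 1, by simp,
      fun _ => isHomogeneous_one _ _, ?_⟩
    rw [esymmTailAdjoin_zero]
    constructor
    · intro c c' h
      funext i
      exact Subtype.ext (by simpa using h)
    · exact fun p => ⟨fun _ => ⟨p, trivial⟩, by simp⟩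
  | succ k ih =>
    obtain ⟨ι, _, d, x, hcard, hd, hx⟩ := ih (by omega)
    refine ⟨ι × Fin (k + 1), inferInstance, fun ij => d ij.1 + ij.2,
      fun ij => x ij.1 * X ⟨k, hk⟩ ^ (ij.2 : ℕ), ?_, fun ij => ?_, ?_⟩
    · simp [hcard, Nat.factorial_succ, mul_comm]
    · have h := (isHomogeneous_X K (⟨k, hk⟩ : Fin n)).pow (ij.2 : ℕ)
      rw [one_mul] at h
      exact (hd ij.1).mul h
    · refine hx.tower (B := esymmTailAdjoin K n (k + 1))
        (y := fun j : Fin (k + 1) => (X ⟨k, hk⟩ : MvPolynomial (Fin n) K) ^ (j : ℕ)) (fun c => ?_)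
        (eq_zero_of_sum_eq_zero hk) fun p => exists_sum_eq_of_mem_esymmTailAdjoin hk
      exact Subalgebra.sum_mem _ fun j _ => Subalgebra.mul_mem _ (esymmTailAdjoin_succ_le (c j).2)
        (Subalgebra.pow_mem _ (X_mem_esymmTailAdjoin (j := ⟨k, hk⟩) le_rfl) _)

lemma isHomogeneous_esymm (σ R : Type*) [Fintype σ] [CommSemiring R] (m : ℕ) :
    (esymm σ R m).IsHomogeneous m := by
  refine IsHomogeneous.sum _ _ _ fun t ht => ?_
  simpa [(Finset.mem_powersetCard.mp ht).2] using
    IsHomogeneous.prod t _ (fun _ => 1) fun i _ => isHomogeneous_X R i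

lemma exists_basis_esymm_pow_mul (n : ℕ) :
    ∃ (ι : Type) (_ : Fintype ι) (d : ι → ℕ) (x : ι → MvPolynomial (Fin n) K)
      (b : Module.Basis (ι × (Fin n →₀ ℕ)) K (MvPolynomial (Fin n) K)),
      Fintype.card ι = n.factorial ∧ (∀ i, (x i).IsHomogeneous (d i)) ∧
        ∀ a m, b (a, m) = x a * ∏ i : Fin n, esymm (Fin n) K ((i : ℕ) + 1) ^ m i := by
  classical
  obtain ⟨ι, _, d, x, hcard, hd, hx⟩ := exists_isBasisOver_esymmTailAdjoin (K := K) (le_refl n)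
  rw [esymmTailAdjoin_self] at hx
  have hinj : Function.Injective
      (aeval (R := K) fun i : Fin n => esymm (Fin n) K ((i : ℕ) + 1)) := by
    intro p q h
    refine esymmAlgHom_fin_injective K (le_refl n) (Subtype.ext ?_)
    rw [esymmAlgHom_apply, esymmAlgHom_apply, h]
  let ψ := aeval (R := K) fun i : Fin n => esymm (Fin n) K ((i : ℕ) + 1)
  let Φ : (ι → MvPolynomial (Fin n) K) →ₗ[K] MvPolynomial (Fin n) K :=
    ∑ a, LinearMap.mulRight K (x a) ∘ₗ ψ.toLinearMap ∘ₗ LinearMap.proj a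
  have hΦ_apply (c : ι → MvPolynomial (Fin n) K) : Φ c = ∑ a, ψ (c a) * x a := by
    rw [LinearMap.sum_apply]
    rfl
  have hΦ : Function.Bijective Φ := by
    let e := AlgEquiv.ofInjective ψ hinj
    convert hx.comp (Equiv.piCongrRight fun _ : ι => e.toEquiv).bijective using 1
    exact funext hΦ_apply
  refine ⟨ι, inferInstance, d, x, ((Pi.basis fun _ : ι => basisMonomials (Fin n) K).map
    (LinearEquiv.ofBijective Φ hΦ)).reindex (Equiv.sigmaEquivProd _ _), hcard, hd, fun a m => ?_⟩
  have hψ : ψ (monomial m 1) = ∏ i : Fin n, esymm (Fin n) K ((i : ℕ) + 1) ^ m i := by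
    rw [aeval_monomial, map_one, one_mul, Finsupp.prod_fintype _ _ fun _ => pow_zero _]
  rw [Module.Basis.reindex_apply, Module.Basis.map_apply, Equiv.sigmaEquivProd_symm_apply,
    Pi.basis_apply, LinearEquiv.ofBijective_apply, hΦ_apply, Finset.sum_eq_single a]
  · rw [Pi.single_eq_same, coe_basisMonomials, hψ, mul_comm]
  · intro a' _ ha'
    rw [Pi.single_eq_of_ne ha', map_zero, zero_mul]
  · simp

end StaircaseBasis

/-- If `g_1,…,g_n` have `deg g_i < i`, then the perturbed elementary symmetric
polynomials `e_1 + g_1, …, e_n + g_n` form a regular sequence in `K[v_1,…,v_n]`,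
and the quotient by the ideal they generate has dimension `n!` over `K`. -/
theorem perturbed_esymm_regular_and_finrank
    (K : Type*) [Field K] [CharZero K] (n : ℕ)
    (g : Fin n → MvPolynomial (Fin n) K)
    (hg : ∀ i : Fin n, (g i).totalDegree < (i : ℕ) + 1) :
    RingTheory.Sequence.IsRegular (MvPolynomial (Fin n) K)
        (List.ofFn fun i : Fin n => MvPolynomial.esymm (Fin n) K ((i : ℕ) + 1) + g i) ∧
      Module.finrank K
        (MvPolynomial (Fin n) K ⧸
          Ideal.span (Set.range fun i : Fin n =>
            MvPolynomial.esymm (Fin n) K ((i : ℕ) + 1) + g i)) = Nat.factorial n := by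
  classical
  obtain ⟨ι, _, d, x, b, hcard, hd, hb⟩ := exists_basis_esymm_pow_mul (K := K) n
  let f : Fin n → MvPolynomial (Fin n) K := fun i => esymm (Fin n) K ((i : ℕ) + 1) + g i
  have hf (i : Fin n) : SameLeadingForm ((i : ℕ) + 1) (esymm (Fin n) K ((i : ℕ) + 1)) (f i) :=
    ⟨(isHomogeneous_esymm _ _ _).mem_degreeFiltration,
      by simpa [f] using mem_degreeFiltration_of_totalDegree_lt (hg i)⟩
  obtain ⟨b', hb'⟩ := exists_basis_of_sameLeadingForm b
    (fun j => d j.1 + ∑ i : Fin n, j.2 i * ((i : ℕ) + 1))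
    (fun ⟨a, m⟩ => by
      rw [hb]
      refine (hd a).mul (IsHomogeneous.prod _ _ _ fun i _ => ?_)
      rw [mul_comm]
      exact (isHomogeneous_esymm _ _ _).pow _)
    (fun j => x j.1 * ∏ i, f i ^ j.2 i)
    (fun ⟨a, m⟩ => by
      rw [hb]
      exact (SameLeadingForm.refl_of_isHomogeneous (hd a)).mul
        (SameLeadingForm.prod _ fun i _ => (hf i).pow _))
  have hshift (a : ι) (m : Fin n →₀ ℕ) (i : Fin n) :
      f i * b' (a, m) = b' (a, m + Finsupp.single i 1) := by
    simp only [hb', Finsupp.add_apply, pow_add, Finset.prod_mul_distrib, Finsupp.single_apply,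
      pow_ite, pow_one, pow_zero, Finset.prod_ite_eq, Finset.mem_univ, if_true]
    ring
  have : Nonempty ι := Fintype.card_pos_iff.mp (hcard ▸ n.factorial_pos)
  exact ⟨isRegular_ofFn hshift, hcard ▸ finrank_quotient_span_range hshift⟩
end
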